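/- arXiv:2406.09746 — 3 statements merged into one kernel-verified Lean document; each statement's English description precedes it below -/
import Mathlib

section
/- For ν > 0, σ'_ν(6) := ∑_{k∈ℤ∖{0}} 1/(j'_{ν,k})⁶ = (ν³ + 16ν² + 38ν + 24)/(16ν³(ν+1)³(ν+2)(ν+3)). -/
open Finset

/-- The Bessel function of the first kind of order `ν`, for positive arguments,
given by its power series `J_ν(x) = ∑_k (-1)^k/(k! Γ(ν+k+1)) (x/2)^{2k+ν}`. -/
noncomputable def besselJ (ν : ℝ) (x : ℝ) : ℝ :=
  ∑' k : ℕ, ((-1) ^ k / (k.factorial * Real.Gamma (ν + k + 1))) *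
    (x / 2) ^ (2 * k) * (x / 2) ^ ν

/-- `jz : ℤ → ℝ` enumerates the zeros of `J_ν'`: for `k ≥ 1`, `jz k = j'_{ν,k}`
is the `k`-th positive zero of `J_ν'` (in increasing order), and `jz (-k) = -jz k`. -/
structure IsBesselDerivZeros (ν : ℝ) (jz : ℤ → ℝ) : Prop where
  odd_sym : ∀ k : ℤ, jz (-k) = -jz k
  mono : ∀ k l : ℤ, 1 ≤ k → k < l → jz k < jz l
  gt_nu : ∀ k : ℤ, 1 ≤ k → ν < jz k
  is_zero : ∀ k : ℤ, 1 ≤ k → deriv (besselJ ν) (jz k) = 0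
  complete : ∀ x : ℝ, 0 < x → deriv (besselJ ν) x = 0 → ∃ k : ℤ, 1 ≤ k ∧ jz k = x

open Filter Topology Polynomial

namespace RS

lemma rolle_count (f f' : ℝ → ℝ) (hc : ContinuousOn f (Set.Ici 0))
    (hd : ∀ x, 0 < x → HasDerivAt f (f' x) x) (S : Finset ℝ) :
    S.Nonempty → (∀ x ∈ S, 0 ≤ x ∧ f x = 0) →
    ∃ T : Finset ℝ, T.card + 1 = S.card ∧ ∀ x ∈ T, 0 < x ∧ f' x = 0 ∧ ∃ y ∈ S, x < y := by
  induction S using Finset.induction_on_max with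
  | empty => intro h; simp at h
  | insert a s hlt ih =>
    intro _ h
    have ha : a ∉ s := fun h' => lt_irrefl _ (hlt a h')
    rcases s.eq_empty_or_nonempty with rfl | hs
    · exact ⟨∅, by simp⟩
    · obtain ⟨T, hT, hT2⟩ := ih hs (fun x hx => h x (Finset.mem_insert_of_mem hx))
      have hm := s.max'_mem hs
      have hma := hlt _ hm
      obtain ⟨hm0, hmf⟩ := h _ (Finset.mem_insert_of_mem hm)
      obtain ⟨ha0, haf⟩ := h a (Finset.mem_insert_self _ _)
      obtain ⟨c, hcc, hc0⟩ := exists_hasDerivAt_eq_zero (f := f) (f' := f') hma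
        (hc.mono (fun x hx => hm0.trans hx.1)) (by rw [hmf, haf])
        (fun x hx => hd x (hm0.trans_lt hx.1))
      have hcT : c ∉ T := by
        intro hcT
        obtain ⟨_, _, y, hy, hcy⟩ := hT2 c hcT
        exact absurd (hcy.trans_le (s.le_max' y hy)) (not_lt.2 hcc.1.le)
      refine ⟨insert c T, ?_, ?_⟩
      · rw [Finset.card_insert_of_notMem hcT, Finset.card_insert_of_notMem ha, hT]
      · intro x hx
        rcases Finset.mem_insert.1 hx with rfl | hx
        · exact ⟨hm0.trans_lt hcc.1, hc0, a, Finset.mem_insert_self _ _, hcc.2⟩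
        · obtain ⟨h1, h2, y, hy, hxy⟩ := hT2 x hx
          exact ⟨h1, h2, y, Finset.mem_insert_of_mem hy, hxy⟩

lemma rolle_inf (f f' : ℝ → ℝ) (hc : ContinuousOn f (Set.Ici 0))
    (hd : ∀ x, 0 < x → HasDerivAt f (f' x) x) (ht : Tendsto f atTop (𝓝 0)) (r : ℝ)
    (hr : 0 ≤ r) (hfr : f r = 0) : ∃ c, r < c ∧ f' c = 0 := by
  by_cases h : ∀ x, r < x → f x = 0
  · obtain ⟨c, hcc, hc0⟩ := exists_hasDerivAt_eq_zero (f := f) (f' := f') (lt_add_one r)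
        (hc.mono (fun x hx => hr.trans hx.1)) (by rw [hfr, h _ (lt_add_one r)])
        (fun x hx => hd x (hr.trans_lt hx.1))
    exact ⟨c, hcc.1, hc0⟩
  · push Not at h
    obtain ⟨b, hb, hfb⟩ := h
    have h1 : Tendsto (fun x => f x ^ 2) atTop (𝓝 0) := by simpa using ht.pow 2
    have h2 : ∀ᶠ x in atTop, f x ^ 2 < f b ^ 2 := h1.eventually_lt_const (by positivity)
    obtain ⟨N, hN, hbN⟩ := (h2.and (eventually_gt_atTop b)).exists
    have hcont : ContinuousOn (fun x => f x ^ 2) (Set.Icc r N) :=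
      (hc.mono (fun x hx => hr.trans hx.1)).pow 2
    obtain ⟨c, hcm, hmax⟩ := isCompact_Icc.exists_isMaxOn ⟨b, hb.le, hbN.le⟩ hcont
    have hbc : f b ^ 2 ≤ f c ^ 2 := hmax ⟨hb.le, hbN.le⟩
    have hfb2 : 0 < f b ^ 2 := by positivity
    have hfc : f c ≠ 0 := by
      intro h0; rw [h0] at hbc; norm_num at hbc; exact hfb hbc
    have hcr : r < c := lt_of_le_of_ne hcm.1 (by rintro rfl; exact hfc hfr)
    have hcN : c < N := lt_of_le_of_ne hcm.2 (by rintro rfl; linarith)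
    have hloc : IsLocalMax (fun x => f x ^ 2) c := hmax.isLocalMax (Icc_mem_nhds hcr hcN)
    have := hloc.hasDerivAt_eq_zero ((hd c (hr.trans_lt hcr)).pow 2)
    refine ⟨c, hcr, ?_⟩
    simpa [hfc] using this

lemma wcont (a : ℝ) (ha : 0 < a) (p : ℝ[X]) :
    ContinuousOn (fun x : ℝ => x ^ a * p.eval x) (Set.Ici 0) := by
  refine ContinuousOn.mul ?_ p.continuous.continuousOn
  exact (Real.continuous_rpow_const ha.le).continuousOn

lemma wder (a : ℝ) (p : ℝ[X]) (x : ℝ) (hx : 0 < x) :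
    HasDerivAt (fun x : ℝ => x ^ a * p.eval x)
      (x ^ (a - 1) * (a * p.eval x + x * p.derivative.eval x)) x := by
  have h1 := (Real.hasDerivAt_rpow_const (x := x) (p := a) (Or.inl hx.ne')).mul (p.hasDerivAt x)
  refine h1.congr_deriv ?_
  have : x ^ a = x ^ (a - 1) * x := by
    rw [Real.rpow_sub_one hx.ne']; field_simp
  rw [this]; ring

lemma step1 (a : ℝ) (ha : 0 < a) (p q : ℝ[X])
    (hq : q = C a * p + X * p.derivative)
    (S : Finset ℝ) (hS : ∀ x ∈ S, 0 < x ∧ p.eval x = 0) :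
    ∃ T : Finset ℝ, T.card = S.card ∧ ∀ x ∈ T, 0 < x ∧ q.eval x = 0 := by
  have h0 : (0 : ℝ) ∉ S := fun h => lt_irrefl _ (hS 0 h).1
  obtain ⟨T, hT, hT2⟩ := rolle_count _ _ (wcont a ha p) (wder a p) (insert 0 S)
    (Finset.insert_nonempty _ _) (by
      intro x hx
      rcases Finset.mem_insert.1 hx with rfl | hx
      · simp [Real.zero_rpow ha.ne']
      · exact ⟨(hS x hx).1.le, by simp [(hS x hx).2]⟩)
  rw [Finset.card_insert_of_notMem h0] at hT
  refine ⟨T, by omega, fun x hx => ?_⟩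
  obtain ⟨h1, h2, -⟩ := hT2 x hx
  refine ⟨h1, ?_⟩
  have : x ^ (a - 1) ≠ 0 := (Real.rpow_pos_of_pos h1 _).ne'
  rw [hq]; simpa [this] using h2

lemma wtend (a : ℝ) (p : ℝ[X]) :
    Tendsto (fun x : ℝ => x ^ a * p.eval x * Real.exp (-x)) atTop (𝓝 0) := by
  have h : Tendsto (fun x : ℝ => ∑ i ∈ Finset.range (p.natDegree + 1),
      p.coeff i * (x ^ (a + i) * Real.exp (-1 * x))) atTop (𝓝 0) := by
    rw [show (0 : ℝ) = ∑ i ∈ Finset.range (p.natDegree + 1), p.coeff i * 0 by simp]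
    exact tendsto_finsetSum _ (fun i _ =>
      (tendsto_rpow_mul_exp_neg_mul_atTop_nhds_zero (a + i) 1 one_pos).const_mul _)
  refine h.congr' ?_
  filter_upwards [eventually_gt_atTop 0] with x hx
  rw [Polynomial.eval_eq_sum_range, Finset.mul_sum, Finset.sum_mul]
  refine Finset.sum_congr rfl fun i _ => ?_
  rw [Real.rpow_add hx, Real.rpow_natCast]
  ring_nf

lemma step2 (a : ℝ) (ha : 0 < a) (p q : ℝ[X])
    (hq : q = (C a - X) * p + X * p.derivative)
    (S : Finset ℝ) (hS : ∀ x ∈ S, 0 < x ∧ p.eval x = 0) :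
    ∃ T : Finset ℝ, T.card = S.card + 1 ∧ ∀ x ∈ T, 0 < x ∧ q.eval x = 0 := by
  have h0 : (0 : ℝ) ∉ S := fun h => lt_irrefl _ (hS 0 h).1
  set f := fun x : ℝ => x ^ a * p.eval x * Real.exp (-x)
  set f' := fun x : ℝ => x ^ (a - 1) * Real.exp (-x) * q.eval x
  have hfc : ContinuousOn f (Set.Ici 0) :=
    (wcont a ha p).mul (by fun_prop)
  have hfd : ∀ x, 0 < x → HasDerivAt f (f' x) x := by
    intro x hx
    have := (wder a p x hx).mul ((hasDerivAt_id x).neg.exp)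
    refine this.congr_deriv ?_
    have h3 : x ^ a = x ^ (a - 1) * x := by
      rw [Real.rpow_sub_one hx.ne']; field_simp
    simp only [f', hq, h3, Pi.neg_apply, id]
    simp
    ring
  have hz : ∀ x ∈ insert 0 S, 0 ≤ x ∧ f x = 0 := by
    intro x hx
    rcases Finset.mem_insert.1 hx with rfl | hx
    · simp [f, Real.zero_rpow ha.ne']
    · exact ⟨(hS x hx).1.le, by simp [f, (hS x hx).2]⟩
  obtain ⟨T, hT, hT2⟩ := rolle_count f f' hfc hfd (insert 0 S)
    (Finset.insert_nonempty _ _) hz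
  rw [Finset.card_insert_of_notMem h0] at hT
  set m := (insert 0 S).max' (Finset.insert_nonempty _ _) with hm
  obtain ⟨hm0, hmf⟩ := hz m (Finset.max'_mem _ _)
  obtain ⟨c, hcm, hc0⟩ := rolle_inf f f' hfc hfd (wtend a p) m hm0 hmf
  have hcT : c ∉ T := by
    intro h
    obtain ⟨_, _, y, hy, hcy⟩ := hT2 c h
    have := Finset.le_max' _ y hy
    linarith
  have key : ∀ x, 0 < x → f' x = 0 → q.eval x = 0 := by
    intro x h1 h2
    have : x ^ (a - 1) ≠ 0 := (Real.rpow_pos_of_pos h1 _).ne'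
    simpa [f', this, Real.exp_ne_zero] using h2
  refine ⟨insert c T, by rw [Finset.card_insert_of_notMem hcT]; omega, fun x hx => ?_⟩
  rcases Finset.mem_insert.1 hx with rfl | hx
  · exact ⟨hm0.trans_lt hcm, key _ (hm0.trans_lt hcm) hc0⟩
  · exact ⟨(hT2 x hx).1, key _ (hT2 x hx).1 (hT2 x hx).2.1⟩

/-- polynomial from coefficients -/
noncomputable def mk (n : ℕ) (a : ℕ → ℝ) : ℝ[X] :=
  ∑ k ∈ Finset.range (n + 1), monomial k (a k)

lemma mk_coeff (n : ℕ) (a : ℕ → ℝ) (ha : ∀ k, n < k → a k = 0) (k : ℕ) :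
    (mk n a).coeff k = a k := by
  simp only [mk, finsetSum_coeff, coeff_monomial]
  rw [Finset.sum_ite_eq' ]
  split_ifs with h
  · rfl
  · rw [ha]; simpa using h

noncomputable def lagc (n : ℕ) (α : ℝ) (k : ℕ) : ℝ :=
  n.choose k * (-1) ^ k / Real.Gamma (α + k + 1)

lemma lagc_zero (n : ℕ) (α : ℝ) (k : ℕ) (h : n < k) : lagc n α k = 0 := by
  simp [lagc, Nat.choose_eq_zero_of_lt h]

lemma lag_rec (n : ℕ) (α : ℝ) (hα : 0 ≤ α) :
    mk (n + 1) (lagc (n + 1) α) =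
      (C (α + 1) - X) * mk n (lagc n (α + 1)) + X * (mk n (lagc n (α + 1))).derivative := by
  ext k
  rw [mk_coeff _ _ (lagc_zero _ _)]
  rw [sub_mul, coeff_add, coeff_sub, coeff_C_mul, mk_coeff _ _ (lagc_zero _ _)]
  cases k with
  | zero =>
    simp [lagc]
    rw [Real.Gamma_add_one (by positivity : α + 1 ≠ 0)]
    have := (Real.Gamma_pos_of_pos (by positivity : 0 < α + 1)).ne'
    field_simp
  | succ k =>
    rw [coeff_X_mul, coeff_X_mul, coeff_derivative, mk_coeff _ _ (lagc_zero _ _),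
      mk_coeff _ _ (lagc_zero _ _)]
    simp only [lagc, Nat.choose_succ_succ]
    push_cast
    have e1 : α + 1 + ((k : ℝ) + 1) + 1 = (α + k + 2) + 1 := by ring
    have e2 : α + ((k : ℝ) + 1) + 1 = α + k + 2 := by ring
    have e3 : α + 1 + (k : ℝ) + 1 = α + k + 2 := by ring
    rw [e1, e2, e3, Real.Gamma_add_one (by positivity)]
    have := (Real.Gamma_pos_of_pos (by positivity : 0 < α + k + 2)).ne'
    have : α + k + 2 ≠ 0 := by positivity
    field_simp
    ring

lemma lag_roots (n : ℕ) : ∀ α : ℝ, 0 ≤ α →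
    ∃ S : Finset ℝ, S.card = n ∧ ∀ x ∈ S, 0 < x ∧ (mk n (lagc n α)).eval x = 0 := by
  induction n with
  | zero => intro α _; exact ⟨∅, by simp⟩
  | succ n ih =>
    intro α hα
    obtain ⟨S, hS, hS2⟩ := ih (α + 1) (by positivity)
    obtain ⟨T, hT, hT2⟩ := step2 (α + 1) (by positivity) _ _ (lag_rec n α hα) S hS2
    exact ⟨T, by omega, hT2⟩

/-- weights -/
noncomputable def w (n k : ℕ) : ℝ := n.descFactorial k / (n : ℝ) ^ k

/-- coefficients of the entire function -/
noncomputable def c (ν : ℝ) (k : ℕ) : ℝ :=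
  (-1) ^ k * (2 * k + ν) / (k.factorial * Real.Gamma (ν + k + 1))

noncomputable def P (ν : ℝ) (n : ℕ) : ℝ[X] := mk n (fun k => c ν k * w n k)

lemma P_coeff (ν : ℝ) (n k : ℕ) : (P ν n).coeff k = c ν k * w n k := by
  rw [P, mk_coeff]
  intro k hk
  simp [w, Nat.descFactorial_of_lt hk]

lemma P_roots (ν : ℝ) (hν : 0 < ν) (n : ℕ) :
    ∃ S : Finset ℝ, S.card = n ∧ ∀ x ∈ S, 0 < x ∧ (P ν n).eval x = 0 := by
  rcases Nat.eq_zero_or_pos n with rfl | hn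
  · exact ⟨∅, by simp⟩
  obtain ⟨S, hS, hS2⟩ := lag_roots n ν hν.le
  obtain ⟨T, hT, hT2⟩ := step1 (ν / 2) (by positivity) _ _ rfl S hS2
  have hn' : (n : ℝ) ≠ 0 := by positivity
  refine ⟨T.image (fun x => n * x), ?_, ?_⟩
  · rw [Finset.card_image_of_injective _ (mul_right_injective₀ hn')]; omega
  intro y hy
  obtain ⟨x, hx, rfl⟩ := Finset.mem_image.1 hy
  obtain ⟨hx0, hx1⟩ := hT2 x hx
  refine ⟨by positivity, ?_⟩
  have : C (2 : ℝ) * (C (ν / 2) * mk n (lagc n ν) + X * derivative (mk n (lagc n ν))) =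
      (P ν n).comp (C (n : ℝ) * X) := by
    ext k
    rw [comp_C_mul_X_coeff, P_coeff, coeff_C_mul, coeff_add, coeff_C_mul,
      mk_coeff _ _ (lagc_zero _ _)]
    have h2 : (X * derivative (mk n (lagc n ν))).coeff k = k * lagc n ν k := by
      cases k with
      | zero => simp
      | succ k => rw [coeff_X_mul, coeff_derivative, mk_coeff _ _ (lagc_zero _ _)]; push_cast; ring
    rw [h2]
    simp only [lagc, c, w, Nat.descFactorial_eq_factorial_mul_choose]
    push_cast
    have := (Real.Gamma_pos_of_pos (by positivity : 0 < ν + k + 1)).ne'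
    have : (k.factorial : ℝ) ≠ 0 := by positivity
    field_simp
    ring
  have h3 := congrArg (eval x) this
  rw [eval_mul, hx1, eval_comp] at h3
  simpa using h3.symm

lemma newton (S : Finset ℝ) : 
    (∏ r ∈ S, (1 - C r⁻¹ * X)).coeff 0 = 1 ∧
    ∑ r ∈ S, r⁻¹ = - (∏ r ∈ S, (1 - C r⁻¹ * X)).coeff 1 ∧ 
    ∑ r ∈ S, (r⁻¹) ^ 2 = (∏ r ∈ S, (1 - C r⁻¹ * X)).coeff 1 ^ 2 
      - 2 * (∏ r ∈ S, (1 - C r⁻¹ * X)).coeff 2 ∧ 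
    ∑ r ∈ S, (r⁻¹) ^ 3 = - (∏ r ∈ S, (1 - C r⁻¹ * X)).coeff 1 ^ 3 
      + 3 * (∏ r ∈ S, (1 - C r⁻¹ * X)).coeff 1 * (∏ r ∈ S, (1 - C r⁻¹ * X)).coeff 2
      - 3 * (∏ r ∈ S, (1 - C r⁻¹ * X)).coeff 3 := by
  induction S using Finset.induction_on with
  | empty => simp [coeff_one]
  | insert a s ha ih =>
    simp only [Finset.prod_insert ha, Finset.sum_insert ha]
    set Q := ∏ r ∈ s, (1 - C r⁻¹ * X)
    obtain ⟨h0, h1, h2, h3⟩ := ih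
    have e : ∀ k, ((1 - C a⁻¹ * X) * Q).coeff (k + 1) = Q.coeff (k + 1) - a⁻¹ * Q.coeff k := by
      intro k
      rw [sub_mul, one_mul, mul_assoc, coeff_sub, coeff_C_mul, coeff_X_mul]
    have e1 := e 0
    have e2 := e 1
    have e3 := e 2
    norm_num at e1 e2 e3
    have e0 : ((1 - C a⁻¹ * X) * Q).coeff 0 = 1 := by
      rw [mul_coeff_zero, h0]; simp
    refine ⟨e0, ?_, ?_, ?_⟩
    · rw [e1, h1, h0]; ring
    · rw [e1, e2, h2, h0]; ring
    · rw [e1, e2, e3, h3, h0]; ring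

lemma c_zero_ne (ν : ℝ) (hν : 0 < ν) (k : ℕ) : c ν k ≠ 0 := by
  have := (Real.Gamma_pos_of_pos (by positivity : 0 < ν + k + 1)).ne'
  have : (2 * k + ν : ℝ) ≠ 0 := by positivity
  have : (k.factorial : ℝ) ≠ 0 := by positivity
  simp only [c]
  positivity

lemma P_natDegree (ν : ℝ) (n : ℕ) : (P ν n).natDegree ≤ n := by
  rw [natDegree_le_iff_coeff_eq_zero]
  intro k hk
  rw [P_coeff]; simp [w, Nat.descFactorial_of_lt hk]

lemma P_ne (ν : ℝ) (hν : 0 < ν) (n : ℕ) : P ν n ≠ 0 := by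
  intro h
  have := P_coeff ν n 0
  rw [h] at this
  simp [w] at this
  exact c_zero_ne ν hν 0 this.symm

lemma P_fact (ν : ℝ) (hν : 0 < ν) (n : ℕ) (S : Finset ℝ) (hS : S.card = n)
    (hS2 : ∀ x ∈ S, 0 < x ∧ (P ν n).eval x = 0) :
    (∀ x, (P ν n).eval x = 0 → x ∈ S) ∧
    P ν n = C (c ν 0) * ∏ r ∈ S, (1 - C r⁻¹ * X) := by
  have hle : S.val ≤ (P ν n).roots := by
    rw [Multiset.le_iff_subset S.nodup]
    intro x hx
    rw [mem_roots (P_ne ν hν n)]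
    exact (hS2 x hx).2
  have hcard : (P ν n).roots.card ≤ S.val.card := by
    refine (card_roots' _).trans ((P_natDegree ν n).trans ?_)
    rw [Finset.card_val, hS]
  have heq := Multiset.eq_of_le_of_card_le hle hcard
  constructor
  · intro x hx
    rw [← Finset.mem_val, heq, mem_roots (P_ne ν hν n)]; exact hx
  · have hdeg : (P ν n).roots.card = (P ν n).natDegree := by
      refine le_antisymm (card_roots' _) ((P_natDegree ν n).trans ?_)
      rw [← heq, Finset.card_val, hS]
    have h1 := C_leadingCoeff_mul_prod_multiset_X_sub_C hdeg
    rw [← heq] at h1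
    have h2 : (Multiset.map (fun a => X - C a) S.val).prod = ∏ r ∈ S, (X - C r) := rfl
    have h3 : ∏ r ∈ S, (X - C r) = C (∏ r ∈ S, (-r)) * ∏ r ∈ S, (1 - C r⁻¹ * X) := by
      rw [map_prod, ← Finset.prod_mul_distrib]
      refine Finset.prod_congr rfl fun r hr => ?_
      have : C r * C r⁻¹ = (1 : ℝ[X]) := by
        rw [← C_mul, mul_inv_cancel₀ (hS2 r hr).1.ne', C_1]
      rw [C_neg]
      linear_combination -X * this
    rw [h2, h3, ← mul_assoc, ← C_mul] at h1
    have h4 := congrArg (fun p => p.coeff 0) h1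
    simp only [coeff_C_mul, (newton S).1, P_coeff] at h4
    have : w n 0 = 1 := by simp [w]
    rw [this, mul_one, mul_one] at h4
    rw [← h1, h4]

def Bd (a : ℕ → ℝ) : Prop :=
  ∃ A B : ℝ, 0 ≤ A ∧ 0 ≤ B ∧ ∀ k, |a k| ≤ A * B ^ k / (k.factorial : ℝ)

noncomputable def E (a : ℕ → ℝ) (y : ℝ) : ℝ := ∑' k, a k * y ^ k

def D (a : ℕ → ℝ) (k : ℕ) : ℝ := (k + 1) * a (k + 1)

lemma Bd.summ {a : ℕ → ℝ} (h : Bd a) (R : ℝ) (hR : 0 ≤ R) :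
    Summable (fun k => |a k| * R ^ k) := by
  obtain ⟨A, B, hA, hB, h⟩ := h
  refine Summable.of_nonneg_of_le (fun k => by positivity) (fun k => ?_)
    ((Real.summable_pow_div_factorial (B * R)).mul_left A)
  calc |a k| * R ^ k ≤ (A * B ^ k / (k.factorial : ℝ)) * R ^ k := by gcongr; exact h k
    _ = _ := by rw [mul_pow]; ring

lemma Bd.summ' {a : ℕ → ℝ} (h : Bd a) (y : ℝ) : Summable (fun k => a k * y ^ k) := by
  refine Summable.of_norm ?_
  simpa [abs_mul, abs_pow] using h.summ |y| (abs_nonneg y)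

lemma Bd.D {a : ℕ → ℝ} (h : Bd a) : Bd (D a) := by
  obtain ⟨A, B, hA, hB, h⟩ := h
  refine ⟨A * B, B, by positivity, hB, fun k => ?_⟩
  have h1 := h (k + 1)
  rw [RS.D, abs_mul, abs_of_nonneg (by positivity : (0 : ℝ) ≤ k + 1)]
  calc ((k : ℝ) + 1) * |a (k + 1)| ≤ (k + 1) * (A * B ^ (k + 1) / ((k + 1).factorial : ℝ)) := by
        gcongr
    _ = _ := by
      rw [Nat.factorial_succ]; push_cast
      field_simp
      ring

lemma E_shift {a : ℕ → ℝ} (h : Bd a) (y : ℝ) : E a y = a 0 + y * E (fun k => a (k + 1)) y := by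
  rw [E, (h.summ' y).tsum_eq_zero_add, E, ← tsum_mul_left]
  simp only [pow_zero, mul_one]
  congr 1
  refine tsum_congr fun k => ?_
  rw [pow_succ]; ring

lemma E_deriv {a : ℕ → ℝ} (h : Bd a) (y : ℝ) : HasDerivAt (E a) (E (D a) y) y := by
  set R := |y| + 1 with hR
  have hR0 : 0 ≤ R := by positivity
  have hu : Summable (fun n : ℕ => |a n| * (n * R ^ (n - 1))) := by
    rw [← summable_nat_add_iff 1]
    refine (h.D.summ R hR0).congr fun k => ?_
    rw [D, abs_mul, abs_of_nonneg (by positivity : (0 : ℝ) ≤ k + 1)]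
    simp
    ring
  have := hasDerivAt_tsum_of_isPreconnected (𝕜 := ℝ) (F := ℝ) (g := fun n z => a n * z ^ n)
    (g' := fun n z => a n * (n * z ^ (n - 1))) (t := Metric.ball 0 R) (y₀ := 0) (y := y) hu
    Metric.isOpen_ball (convex_ball _ _).isPreconnected
    (fun n z _ => (hasDerivAt_pow n z).const_mul _)
    (fun n z hz => by
      have hz' : |z| ≤ R := by
        have := Metric.mem_ball.1 hz; rw [Real.dist_eq, sub_zero] at this; exact this.le
      rw [Real.norm_eq_abs, abs_mul, abs_mul, abs_pow, Nat.abs_cast]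
      gcongr)
    (by simp; positivity) (h.summ' 0) (by simp [hR])
  refine this.congr_deriv ?_
  have hs : Summable (fun n : ℕ => a n * (n * y ^ (n - 1))) := by
    refine Summable.of_norm_bounded hu fun n => ?_
    rw [Real.norm_eq_abs, abs_mul, abs_mul, abs_pow, Nat.abs_cast]
    have : |y| ≤ R := by linarith
    gcongr
  rw [hs.tsum_eq_zero_add, E]
  simp only [D]
  simp
  refine tsum_congr fun k => ?_
  ring

lemma E_conv {a : ℕ → ℝ} (h : Bd a) (v : ℕ → ℕ → ℝ) (hv : ∀ n k, |v n k| ≤ 1) (l : Filter ℕ)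
    (hv2 : ∀ k, Tendsto (fun n => v n k) l (𝓝 1)) (y : ℕ → ℝ) (y0 : ℝ)
    (hy : Tendsto y l (𝓝 y0)) :
    Tendsto (fun n => ∑' k, a k * v n k * y n ^ k) l (𝓝 (E a y0)) := by
  have hR : 0 ≤ |y0| + 1 := by positivity
  refine tendsto_tsum_of_dominated_convergence (h.summ (|y0| + 1) hR) ?_ ?_
  · intro k
    simpa using ((hv2 k).const_mul (a k)).mul (hy.pow k)
  · have : ∀ᶠ n in l, |y n| < |y0| + 1 := hy.abs.eventually_lt_const (by linarith)
    filter_upwards [this] with n hn k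
    rw [Real.norm_eq_abs, abs_mul, abs_mul, abs_pow]
    have := hv n k
    have h1 : |a k| * |v n k| ≤ |a k| * 1 := by gcongr
    rw [mul_one] at h1
    gcongr

lemma w_nonneg (n k : ℕ) : 0 ≤ w n k := by unfold w; positivity

lemma w_le (n k : ℕ) : |w n k| ≤ 1 := by
  rw [abs_of_nonneg (w_nonneg n k), w]
  refine div_le_one_of_le₀ ?_ (by positivity)
  exact_mod_cast Nat.descFactorial_le_pow n k

lemma w_tend (k : ℕ) : Tendsto (fun n => w n k) atTop (𝓝 1) := by
  have := isEquivalent_descFactorial k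
  rw [Asymptotics.isEquivalent_iff_tendsto_one] at this
  · exact this
  · filter_upwards [eventually_gt_atTop 0] with n hn
    positivity

noncomputable def b (ν : ℝ) (k : ℕ) : ℝ := (-1) ^ k / (k.factorial * Real.Gamma (ν + k + 1))

lemma gamma_ge (μ : ℝ) (hμ : 0 ≤ μ) (k : ℕ) :
    (μ + 1) ^ k * Real.Gamma (μ + 1) ≤ Real.Gamma (μ + k + 1) := by
  induction k with
  | zero => simp
  | succ k ih =>
    push_cast
    rw [← add_assoc, Real.Gamma_add_one (by positivity : μ + k + 1 ≠ 0), pow_succ]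
    have h0 := Real.Gamma_pos_of_pos (by positivity : 0 < μ + 1)
    have h1 : μ + 1 ≤ μ + k + 1 := by
      have : (0 : ℝ) ≤ k := by positivity
      linarith
    calc _ = (μ + 1) * ((μ + 1) ^ k * Real.Gamma (μ + 1)) := by ring
      _ ≤ _ := by gcongr

lemma b_abs (μ : ℝ) (hμ : 0 ≤ μ) (k : ℕ) :
    |b μ k| ≤ 1 / ((μ + 1) ^ k * Real.Gamma (μ + 1)) / (k.factorial : ℝ) := by
  have h0 := Real.Gamma_pos_of_pos (by positivity : 0 < μ + 1)
  have h1 := Real.Gamma_pos_of_pos (by positivity : 0 < μ + k + 1)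
  rw [b, abs_div, abs_pow, abs_neg, abs_one, one_pow, abs_of_pos (by positivity), div_div,
    mul_comm (k.factorial : ℝ)]
  have := gamma_ge μ hμ k
  gcongr

lemma b_abs' (μ : ℝ) (hμ : 0 ≤ μ) (k : ℕ) :
    |b μ k| ≤ 1 / Real.Gamma (μ + 1) / (k.factorial : ℝ) := by
  refine (b_abs μ hμ k).trans ?_
  have h0 := Real.Gamma_pos_of_pos (by positivity : 0 < μ + 1)
  have : 1 ≤ (μ + 1) ^ k := one_le_pow₀ (by linarith)
  gcongr
  nlinarith

lemma b_bd (μ : ℝ) (hμ : 0 ≤ μ) : Bd (b μ) := by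
  have h0 := Real.Gamma_pos_of_pos (by positivity : 0 < μ + 1)
  exact ⟨1 / Real.Gamma (μ + 1), 1, by positivity, by norm_num, fun k => by
    simpa using b_abs' μ hμ k⟩

lemma c_eq (ν : ℝ) (k : ℕ) : c ν k = b ν k * (2 * k + ν) := by
  simp only [c, b]; ring

lemma c_bd (ν : ℝ) (hν : 0 ≤ ν) : Bd (c ν) := by
  have h0 := Real.Gamma_pos_of_pos (by positivity : 0 < ν + 1)
  refine ⟨1 / Real.Gamma (ν + 1) * (2 + ν), 2, by positivity, by norm_num, fun k => ?_⟩
  rw [c_eq, abs_mul, abs_of_nonneg (by positivity : (0 : ℝ) ≤ 2 * k + ν)]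
  have h1 : (k : ℝ) ≤ 2 ^ k := by exact_mod_cast Nat.lt_two_pow_self.le
  have h2 : (1 : ℝ) ≤ 2 ^ k := one_le_pow₀ (by norm_num)
  have h3 : 2 * k + ν ≤ (2 + ν) * 2 ^ k := by nlinarith
  calc |b ν k| * (2 * k + ν) ≤ (1 / Real.Gamma (ν + 1) / (k.factorial : ℝ)) *
        ((2 + ν) * 2 ^ k) := by
        gcongr
        exact b_abs' ν hν k
    _ = _ := by ring

lemma D_b (ν : ℝ) (hν : 0 ≤ ν) : D (b ν) = fun k => - b (ν + 1) k := by
  funext k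
  simp only [D, b, Nat.factorial_succ]
  push_cast
  rw [show ν + ((k : ℝ) + 1) + 1 = ν + 1 + k + 1 by ring]
  have := (Real.Gamma_pos_of_pos (by positivity : 0 < ν + 1 + k + 1)).ne'
  field_simp
  ring

lemma E_neg (a : ℕ → ℝ) (y : ℝ) : E (fun k => - a k) y = - E a y := by
  simp [E, tsum_neg]

lemma phi_deriv (ν : ℝ) (hν : 0 ≤ ν) (y : ℝ) :
    HasDerivAt (E (b ν)) (- E (b (ν + 1)) y) y := by
  have := E_deriv (b_bd ν hν) y
  rwa [D_b ν hν, E_neg] at this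

lemma phi_rec (ν : ℝ) (hν : 0 ≤ ν) (y : ℝ) :
    E (b ν) y = (ν + 1) * E (b (ν + 1)) y - y * E (b (ν + 2)) y := by
  have h1 := b_bd (ν + 1) (by positivity)
  have h2 := b_bd (ν + 2) (by positivity)
  rw [E_shift (b_bd ν hν), E_shift h1]
  have h3 : ∀ k, b ν (k + 1) = (ν + 1) * b (ν + 1) (k + 1) - b (ν + 2) k := by
    intro k
    simp only [b, Nat.factorial_succ]
    push_cast
    rw [show ν + 1 + ((k : ℝ) + 1) + 1 = (ν + k + 2) + 1 by ring,
      show ν + 2 + (k : ℝ) + 1 = (ν + k + 2) + 1 by ring,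
      show ν + ((k : ℝ) + 1) + 1 = ν + k + 2 by ring, Real.Gamma_add_one (by positivity)]
    have := (Real.Gamma_pos_of_pos (by positivity : 0 < ν + k + 2)).ne'
    have : ν + k + 2 ≠ 0 := by positivity
    field_simp
    ring
  have h4 : b ν 0 = (ν + 1) * b (ν + 1) 0 := by
    simp only [b]
    simp
    rw [Real.Gamma_add_one (by positivity : ν + 1 ≠ 0)]
    have := (Real.Gamma_pos_of_pos (by positivity : 0 < ν + 1)).ne'
    field_simp
  have hs : Summable (fun k => b (ν + 1) (k + 1) * y ^ k) := by
    have : Bd (fun k => b (ν + 1) (k + 1)) := by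
      obtain ⟨A, B, hA, hB, h⟩ := h1
      refine ⟨A * B, B, by positivity, hB, fun k => (h (k + 1)).trans ?_⟩
      rw [pow_succ, ← mul_assoc, mul_right_comm]
      have : ((k.factorial : ℕ) : ℝ) ≤ (k + 1).factorial := by
        exact_mod_cast Nat.factorial_le (Nat.le_succ k)
      gcongr
    exact this.summ' y
  have h5 : E (fun k => b ν (k + 1)) y =
      (ν + 1) * E (fun k => b (ν + 1) (k + 1)) y - E (b (ν + 2)) y := by
    simp only [E]
    rw [← tsum_mul_left, ← (hs.mul_left _).tsum_sub (h2.summ' y)]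
    refine tsum_congr fun k => ?_
    rw [h3]; ring
  rw [h5, h4]; ring

lemma phi_ne (ν : ℝ) (hν : 0 ≤ ν) (y : ℝ) (hy : 0 < y) (h0 : E (b ν) y = 0)
    (h1 : E (b (ν + 1)) y = 0) : False := by
  have hall : ∀ m : ℕ, E (b (ν + m)) y = 0 ∧ E (b (ν + m + 1)) y = 0 := by
    intro m
    induction m with
    | zero => simpa using ⟨h0, h1⟩
    | succ m ih =>
      push_cast
      rw [← add_assoc]
      refine ⟨ih.2, ?_⟩
      have := phi_rec (ν + m) (by positivity) y
      rw [ih.1, ih.2] at this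
      rw [add_assoc, one_add_one_eq_two]
      simpa [hy.ne'] using this
  set K := ∑' k : ℕ, y ^ (k + 1) / ((k + 1).factorial : ℝ) with hK
  have hKs : Summable (fun k : ℕ => y ^ (k + 1) / ((k + 1).factorial : ℝ)) :=
    (summable_nat_add_iff 1).2 (Real.summable_pow_div_factorial y)
  obtain ⟨m, hm⟩ := exists_nat_gt K
  set μ := ν + m with hμ
  have hμ0 : 0 ≤ μ := by positivity
  have hG := Real.Gamma_pos_of_pos (by positivity : 0 < μ + 1)
  have h2 := (hall m).1
  rw [E, ((b_bd μ hμ0).summ' y).tsum_eq_zero_add] at h2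
  have hb0 : b μ 0 = 1 / Real.Gamma (μ + 1) := by simp [b]
  have h3 : ‖∑' k, b μ (k + 1) * y ^ (k + 1)‖ ≤ 1 / ((μ + 1) * Real.Gamma (μ + 1)) * K := by
    refine tsum_of_norm_bounded (hKs.hasSum.mul_left _) fun k => ?_
    rw [Real.norm_eq_abs, abs_mul, abs_of_pos (by positivity : 0 < y ^ (k + 1))]
    have h4 := b_abs μ hμ0 (k + 1)
    have h5 : μ + 1 ≤ (μ + 1) ^ (k + 1) := le_self_pow₀ (by linarith) (by omega)
    calc |b μ (k + 1)| * y ^ (k + 1) ≤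
        1 / ((μ + 1) * Real.Gamma (μ + 1)) / ((k + 1).factorial : ℝ) * y ^ (k + 1) := by
          gcongr
          refine h4.trans ?_
          gcongr
      _ = _ := by ring
  rw [pow_zero, mul_one, hb0] at h2
  rw [show ∑' k, b μ (k + 1) * y ^ (k + 1) = - (1 / Real.Gamma (μ + 1)) by linarith,
    norm_neg, Real.norm_of_nonneg (by positivity), one_div_mul_eq_div,
    div_le_div_iff₀ hG (by positivity)] at h3
  have h6 : μ + 1 ≤ K := by
    rw [one_mul] at h3
    exact le_of_mul_le_mul_right h3 hG
  have : (0 : ℝ) ≤ ν := hν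
  linarith

lemma F_eq (ν : ℝ) (hν : 0 ≤ ν) (y : ℝ) :
    E (c ν) y = ν * E (b ν) y - 2 * y * E (b (ν + 1)) y := by
  have hb := b_bd ν hν
  have h1 : y * E (D (b ν)) y = ∑' k : ℕ, b ν k * k * y ^ k := by
    have hs : Summable (fun k : ℕ => b ν k * k * y ^ k) := by
      rw [← summable_nat_add_iff 1]
      refine ((hb.D.summ' y).mul_left y).congr fun k => ?_
      simp only [D]; push_cast; ring
    rw [hs.tsum_eq_zero_add, E, ← tsum_mul_left]
    simp only [D]
    simp
    refine tsum_congr fun k => ?_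
    ring
  have hs2 : Summable (fun k : ℕ => b ν k * k * y ^ k) := by
    rw [← summable_nat_add_iff 1]
    refine ((hb.D.summ' y).mul_left y).congr fun k => ?_
    simp only [D]; push_cast; ring
  rw [D_b ν hν, E_neg] at h1
  have h2 : E (c ν) y = ν * E (b ν) y + 2 * ∑' k : ℕ, b ν k * k * y ^ k := by
    rw [E, E, ← tsum_mul_left, ← tsum_mul_left,
      ← ((hb.summ' y).mul_left _).tsum_add (hs2.mul_left _)]
    refine tsum_congr fun k => ?_
    rw [c_eq]; ring
  rw [h2, ← h1]; ring

lemma F_simple (ν : ℝ) (hν : 0 < ν) (y : ℝ) (hy : 0 < y) (hy2 : ν ^ 2 ≠ 4 * y)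
    (h0 : E (c ν) y = 0) : E (D (c ν)) y ≠ 0 := by
  intro h1
  have e1 := E_deriv (c_bd ν hν.le) y
  have e2 : HasDerivAt (fun y => ν * E (b ν) y - 2 * y * E (b (ν + 1)) y)
      (ν * (- E (b (ν + 1)) y) - (2 * 1 * E (b (ν + 1)) y +
        2 * y * (- E (b (ν + 1 + 1)) y))) y :=
    ((phi_deriv ν hν.le y).const_mul ν).sub
      (((hasDerivAt_id y).const_mul 2).mul (phi_deriv (ν + 1) (by positivity) y))
  have e3 : E (c ν) = fun y => ν * E (b ν) y - 2 * y * E (b (ν + 1)) y :=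
    funext (F_eq ν hν.le)
  have e4 := (e3 ▸ e1).unique e2
  rw [h1] at e4
  rw [F_eq ν hν.le] at h0
  have e5 := phi_rec ν hν.le y
  rw [show ν + 1 + 1 = ν + 2 by ring] at e4
  have e6 : ν * E (b (ν + 1)) y = 2 * E (b ν) y := by linarith
  have e7 : (ν ^ 2 - 4 * y) * E (b (ν + 1)) y = 0 := by linear_combination ν * e6 + 2 * h0
  have e8 : E (b (ν + 1)) y = 0 := by
    rcases mul_eq_zero.1 e7 with h | h
    · exact absurd (by linarith) hy2
    · exact h
  exact phi_ne ν hν.le y hy (by rw [e8] at e6; linarith) e8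

lemma bessel_eq (ν x : ℝ) : besselJ ν x = (x / 2) ^ ν * E (b ν) (x ^ 2 / 4) := by
  rw [besselJ, tsum_mul_right, mul_comm]
  congr 1
  refine tsum_congr fun k => ?_
  rw [b, pow_mul]
  congr 2
  ring

lemma bessel_deriv (ν : ℝ) (hν : 0 < ν) (x : ℝ) (hx : 0 < x) :
    deriv (besselJ ν) x = 1 / 2 * (x / 2) ^ (ν - 1) * E (c ν) (x ^ 2 / 4) := by
  have h0 : HasDerivAt (fun x : ℝ => x / 2) (1 / 2) x := (hasDerivAt_id x).div_const 2
  have h1 : HasDerivAt (fun x : ℝ => (x / 2) ^ ν) (1 / 2 * ν * (x / 2) ^ (ν - 1)) x :=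
    h0.rpow_const (Or.inl (by positivity))
  have h2 : HasDerivAt (fun x : ℝ => x ^ 2 / 4) (x / 2) x :=
    ((hasDerivAt_pow 2 x).div_const 4).congr_deriv (by norm_num; ring)
  have h3 := h1.mul ((phi_deriv ν hν.le (x ^ 2 / 4)).comp x h2)
  have h4 : besselJ ν = fun x => (x / 2) ^ ν * E (b ν) (x ^ 2 / 4) := funext (bessel_eq ν)
  have h5 := h3.deriv
  have h7 : ((fun x => (x / 2) ^ ν) * E (b ν) ∘ fun x => x ^ 2 / 4) = besselJ ν := h4.symm
  rw [h7] at h5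
  rw [h5, F_eq ν hν.le]
  have h6 : (x / 2) ^ ν = (x / 2) ^ (ν - 1) * (x / 2) := by
    rw [Real.rpow_sub_one (by positivity)]; field_simp
  simp only [Function.comp]
  rw [h6]; ring

lemma bessel_zero_iff (ν : ℝ) (hν : 0 < ν) (x : ℝ) (hx : 0 < x) :
    deriv (besselJ ν) x = 0 ↔ E (c ν) (x ^ 2 / 4) = 0 := by
  rw [bessel_deriv ν hν x hx]
  have : (x / 2) ^ (ν - 1) ≠ 0 := (Real.rpow_pos_of_pos (by positivity) _).ne'
  simp [this]

lemma P_eval (ν : ℝ) (n : ℕ) (y : ℝ) :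
    (P ν n).eval y = ∑' k, c ν k * w n k * y ^ k := by
  rw [eval_eq_sum_range' (Nat.lt_succ_of_le (P_natDegree ν n)), tsum_eq_sum
    (s := Finset.range (n + 1))]
  · simp only [P_coeff]
  · intro k hk
    have : n < k := by simpa using hk
    simp [w, Nat.descFactorial_of_lt this]

lemma P_deriv_eval (ν : ℝ) (n : ℕ) (y : ℝ) :
    (P ν n).derivative.eval y = ∑' k, D (c ν) k * w n (k + 1) * y ^ k := by
  have hd : (P ν n).derivative.natDegree < n + 1 :=
    lt_of_le_of_lt (natDegree_derivative_le _) (by have := P_natDegree ν n; omega)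
  rw [eval_eq_sum_range' hd, tsum_eq_sum (s := Finset.range (n + 1))]
  · refine Finset.sum_congr rfl fun k _ => ?_
    rw [coeff_derivative, P_coeff, D]; ring
  · intro k hk
    have : n < k + 1 := by have : n < k := by simpa using hk
                           omega
    rw [w, Nat.descFactorial_of_lt this]
    simp

lemma P_conv (ν : ℝ) (hν : 0 < ν) (l : Filter ℕ) (hl : l ≤ atTop) (y : ℕ → ℝ) (y0 : ℝ)
    (hy : Tendsto y l (𝓝 y0)) :
    Tendsto (fun n => (P ν n).eval (y n)) l (𝓝 (E (c ν) y0)) := by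
  simp only [P_eval]
  exact E_conv (c_bd ν hν.le) w w_le l (fun k => (w_tend k).mono_left hl) y y0 hy

lemma P_deriv_conv (ν : ℝ) (hν : 0 < ν) (l : Filter ℕ) (hl : l ≤ atTop) (y : ℕ → ℝ) (y0 : ℝ)
    (hy : Tendsto y l (𝓝 y0)) :
    Tendsto (fun n => (P ν n).derivative.eval (y n)) l (𝓝 (E (D (c ν)) y0)) := by
  simp only [P_deriv_eval]
  exact E_conv (c_bd ν hν.le).D (fun n k => w n (k + 1)) (fun n k => w_le n (k + 1)) l
    (fun k => (w_tend (k + 1)).mono_left hl) y y0 hy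

lemma exists_seq (ν : ℝ) (hν : 0 < ν) (n : ℕ) : ∃ s : ℕ → ℝ, (∀ k, 0 ≤ s k) ∧
    (∀ k, s k ≠ 0 → (P ν n).eval (s k)⁻¹ = 0) ∧
    (∀ y, (P ν n).eval y = 0 → ∃ k, s k = y⁻¹) ∧
    (∀ j k, s k ≠ 0 → s j = s k → j = k) ∧
    (∀ k : ℕ, s k ≤ |c ν 1 / c ν 0| / (k + 1)) ∧
    ∑' k, s k ^ 3 = - (c ν 1 * w n 1 / c ν 0) ^ 3
      + 3 * (c ν 1 * w n 1 / c ν 0) * (c ν 2 * w n 2 / c ν 0) - 3 * (c ν 3 * w n 3 / c ν 0) := by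
  obtain ⟨S, hS, hS2⟩ := P_roots ν hν n
  obtain ⟨hmem, hfact⟩ := P_fact ν hν n S hS hS2
  set e := S.orderEmbOfFin hS with he
  have hepos : ∀ i, 0 < e i := fun i => (hS2 _ (S.orderEmbOfFin_mem hS i)).1
  set s : ℕ → ℝ := fun k => if h : k < n then (e ⟨k, h⟩)⁻¹ else 0 with hs
  have hs1 : ∀ k (h : k < n), s k = (e ⟨k, h⟩)⁻¹ := fun k h => by simp [hs, h]
  have hs2 : ∀ k, ¬ k < n → s k = 0 := fun k h => by simp [hs, h]
  have hs0 : ∀ k, 0 ≤ s k := by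
    intro k
    by_cases h : k < n
    · rw [hs1 k h]; exact inv_nonneg.2 (hepos _).le
    · rw [hs2 k h]
  have hsum : ∀ g : ℝ → ℝ, ∑ k ∈ Finset.range n, g (s k) = ∑ r ∈ S, g r⁻¹ := by
    intro g
    rw [Finset.sum_range, ← Finset.map_orderEmbOfFin_univ S hS, Finset.sum_map]
    refine Finset.sum_congr rfl fun i _ => ?_
    rw [hs1 i i.2]
    rfl
  obtain ⟨n0, n1, -, n3⟩ := newton S
  have hc0 := c_zero_ne ν hν 0
  have hco : ∀ k, (∏ r ∈ S, (1 - C r⁻¹ * X)).coeff k = c ν k * w n k / c ν 0 := by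
    intro k
    rw [← P_coeff, hfact, coeff_C_mul]
    field_simp
  rw [hco] at n1
  simp only [hco] at n3
  refine ⟨s, hs0, ?_, ?_, ?_, ?_, ?_⟩
  · intro k hk
    by_cases h : k < n
    · rw [hs1 k h, inv_inv]; exact (hS2 _ (S.orderEmbOfFin_mem hS _)).2
    · exact absurd (hs2 k h) hk
  · intro y hy
    have h1 := hmem y hy
    have h2 : y ∈ Set.range e := by rw [he, Finset.range_orderEmbOfFin]; exact h1
    obtain ⟨i, rfl⟩ := h2
    exact ⟨i, hs1 i i.2⟩
  · intro j k hk hjk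
    have h1 : k < n := by by_contra h; exact hk (hs2 k h)
    have h2 : j < n := by by_contra h; exact hk (hjk ▸ hs2 j h)
    rw [hs1 k h1, hs1 j h2, inv_inj] at hjk
    simpa using e.injective hjk
  · intro k
    by_cases h : k < n
    · rw [le_div_iff₀ (by positivity)]
      have hmono : ∀ i ∈ Finset.range (k + 1), s k ≤ s i := by
        intro i hi
        have hik : i ≤ k := by simpa [Nat.lt_succ_iff] using hi
        rw [hs1 k h, hs1 i (hik.trans_lt h)]
        refine inv_anti₀ (hepos _) (e.monotone ?_)
        simpa using hik
      have h1 := Finset.card_nsmul_le_sum _ _ _ hmono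
      have h2 : ∑ i ∈ Finset.range (k + 1), s i ≤ ∑ i ∈ Finset.range n, s i :=
        Finset.sum_le_sum_of_subset_of_nonneg
          (Finset.range_subset_range.2 h) (fun i _ _ => hs0 i)
      have h3 : ∑ i ∈ Finset.range n, s i ≤ |c ν 1 / c ν 0| := by
        have := hsum id
        simp only [id] at this
        rw [this, n1]
        refine (neg_le_abs _).trans ?_
        rw [mul_div_right_comm, abs_mul]
        have := w_le n 1
        exact mul_le_of_le_one_right (abs_nonneg _) this
      simp at h1
      linarith
    · rw [hs2 k h]; positivity
  · rw [tsum_eq_sum (s := Finset.range n) (fun k hk => by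
      rw [hs2 k (by simpa using hk)]; norm_num)]
    rw [hsum (fun x => x ^ 3), n3]

lemma sign_change (f : ℝ → ℝ) (d z : ℝ) (hf : HasDerivAt f d z) (hd : d ≠ 0) (hz : f z = 0)
    (V : Set ℝ) (hV : V ∈ 𝓝 z) : ∃ a b, Set.uIcc a b ⊆ V ∧ f a * f b < 0 := by
  have key : ∀ (f : ℝ → ℝ) (d : ℝ), HasDerivAt f d z → 0 < d → f z = 0 →
      ∃ a b, Set.uIcc a b ⊆ V ∧ f a * f b < 0 := by
    intro f d hf hd hz
    have h1 := eventually_nhdsWithin_sign_eq_of_deriv_pos (by rw [hf.deriv]; exact hd) hz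
    obtain ⟨ε, hε, hb⟩ := Metric.mem_nhds_iff.1 (Filter.inter_mem h1 hV)
    have ha : z - ε / 2 ∈ Metric.ball z ε := by
      rw [Metric.mem_ball, Real.dist_eq, abs_lt]; constructor <;> linarith
    have hb' : z + ε / 2 ∈ Metric.ball z ε := by
      rw [Metric.mem_ball, Real.dist_eq, abs_lt]; constructor <;> linarith
    refine ⟨z - ε / 2, z + ε / 2, ?_, ?_⟩
    · intro x hx
      refine (hb ?_).2
      rw [Set.uIcc_of_le (by linarith)] at hx
      rw [Metric.mem_ball, Real.dist_eq, abs_lt]; constructor <;> linarith [hx.1, hx.2]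
    · have e1 : SignType.sign (f (z - ε / 2)) = SignType.sign (z - ε / 2 - z) := (hb ha).1
      have e2 : SignType.sign (f (z + ε / 2)) = SignType.sign (z + ε / 2 - z) := (hb hb').1
      rw [sign_neg (by linarith : z - ε / 2 - z < 0), sign_eq_neg_one_iff] at e1
      rw [sign_pos (by linarith : 0 < z + ε / 2 - z), sign_eq_one_iff] at e2
      exact mul_neg_of_neg_of_pos e1 e2
  rcases lt_or_gt_of_ne hd with h | h
  · obtain ⟨a, b, h1, h2⟩ := key (-f) (-d) hf.neg (by linarith) (by simp [hz])
    exact ⟨a, b, h1, by simpa using h2⟩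
  · exact key f d hf h hz

lemma zero_near (ν : ℝ) (hν : 0 < ν) (z : ℝ) (hz : E (c ν) z = 0) (hd : E (D (c ν)) z ≠ 0)
    (V : Set ℝ) (hV : V ∈ 𝓝 z) : ∀ᶠ n in atTop, ∃ y ∈ V, (P ν n).eval y = 0 := by
  obtain ⟨a, b, hab, hneg⟩ := sign_change _ _ z (E_deriv (c_bd ν hν.le) z) hd hz V hV
  have h1 := (P_conv ν hν atTop le_rfl (fun _ => a) a tendsto_const_nhds).mul
    (P_conv ν hν atTop le_rfl (fun _ => b) b tendsto_const_nhds)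
  filter_upwards [h1.eventually_lt_const hneg] with n hn
  have h2 : (0 : ℝ) ∈ Set.uIcc ((P ν n).eval a) ((P ν n).eval b) := by
    rw [Set.mem_uIcc]
    rcases mul_neg_iff.1 hn with h | h
    · exact Or.inr ⟨h.2.le, h.1.le⟩
    · exact Or.inl ⟨h.1.le, h.2.le⟩
  obtain ⟨y, hy, hy0⟩ := intermediate_value_uIcc (P ν n).continuous.continuousOn h2
  exact ⟨y, hab hy, hy0⟩

/-- the limit of third power sums -/
noncomputable def p3 (ν : ℝ) : ℝ := - (c ν 1 / c ν 0) ^ 3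
      + 3 * (c ν 1 / c ν 0) * (c ν 2 / c ν 0) - 3 * (c ν 3 / c ν 0)

lemma main_limit (ν : ℝ) (hν : 0 < ν)
    (hsimple : ∀ y, 0 < y → E (c ν) y = 0 → E (D (c ν)) y ≠ 0) :
    ∃ t : ℕ → ℝ, (∀ k, 0 ≤ t k) ∧ (∀ k, t k ≠ 0 → E (c ν) (t k)⁻¹ = 0) ∧
      (∀ y, 0 < y → E (c ν) y = 0 → ∃ k, t k = y⁻¹) ∧
      (∀ j k, t k ≠ 0 → t j = t k → j = k) ∧ HasSum (fun k => t k ^ 3) (p3 ν) := by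
  choose s s0 s1 s2 s3 s4 s5 using exists_seq ν hν
  set K := |c ν 1 / c ν 0| with hK
  have hK0 : 0 ≤ K := abs_nonneg _
  set U := hyperfilter ℕ with hU
  have hUle : (U : Filter ℕ) ≤ atTop := by
    rw [← Nat.cofinite_eq_atTop]; exact hyperfilter_le_cofinite
  have hlim : ∀ k, ∃ x, Tendsto (fun n => s n k) U (𝓝 x) := by
    intro k
    obtain ⟨x, -, hx⟩ := (isCompact_Icc (a := (0 : ℝ)) (b := K / (k + 1))).ultrafilter_le_nhds'
      (U.map (fun n => s n k)) (by
        rw [Ultrafilter.mem_map]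
        exact Filter.univ_mem' (fun n => ⟨s0 n k, s4 n k⟩))
    exact ⟨x, hx⟩
  choose t ht using hlim
  have t0 : ∀ k, 0 ≤ t k := fun k => ge_of_tendsto' (ht k) (fun n => s0 n k)
  have t4 : ∀ k : ℕ, t k ≤ K / (k + 1) := fun k => le_of_tendsto' (ht k) (fun n => s4 n k)
  have hsb : Summable (fun k : ℕ => (K / ((k : ℝ) + 1)) ^ 3) := by
    have h1 : Summable (fun n : ℕ => 1 / ((n + 1 : ℕ) : ℝ) ^ 3) :=
      (summable_nat_add_iff 1).2 (Real.summable_one_div_nat_pow.2 (by norm_num))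
    refine (h1.mul_left (K ^ 3)).congr fun k => ?_
    push_cast
    rw [div_pow]; ring
  have tz : ∀ k, t k ≠ 0 → E (c ν) (t k)⁻¹ = 0 := by
    intro k hk
    have h1 := P_conv ν hν U hUle _ _ ((ht k).inv₀ hk)
    have h2 : ∀ᶠ n in (U : Filter ℕ), (P ν n).eval (s n k)⁻¹ = 0 := by
      filter_upwards [(ht k).eventually_ne hk] with n hn
      exact s1 n k hn
    exact tendsto_nhds_unique h1 (tendsto_const_nhds.congr' (h2.mono fun n hn => hn.symm))
  refine ⟨t, t0, tz, ?_, ?_, ?_⟩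
  · intro z hz hFz
    by_contra hne
    push Not at hne
    have hzi : 0 < z⁻¹ := inv_pos.2 hz
    obtain ⟨N, hN⟩ := exists_nat_gt (2 * K / z⁻¹)
    have hbig : ∀ n k, N ≤ k → s n k ≤ z⁻¹ / 2 := by
      intro n k hk
      refine (s4 n k).trans ?_
      have : (N : ℝ) ≤ k := by exact_mod_cast hk
      rw [div_lt_iff₀ hzi] at hN
      rw [div_le_div_iff₀ (by positivity) (by norm_num)]
      nlinarith
    -- a neighbourhood avoiding all small limits
    have hW : ∃ W ∈ 𝓝 (z⁻¹), ∀ᶠ n in (U : Filter ℕ), ∀ k ∈ Finset.range N, s n k ∉ W := by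
      have : ∀ k, ∃ W ∈ 𝓝 (z⁻¹), ∀ᶠ n in (U : Filter ℕ), s n k ∉ W := by
        intro k
        obtain ⟨A, B, hA, hB, hAB⟩ := (t2_separation_nhds (hne k))
        have hev : ∀ᶠ n in (U : Filter ℕ), s n k ∈ A := (ht k) hA
        exact ⟨B, hB, hev.mono fun n hn h => Set.disjoint_left.1 hAB hn h⟩
      choose W hW1 hW2 using this
      refine ⟨⋂ k ∈ Finset.range N, W k, ?_, ?_⟩
      · exact (Filter.biInter_finset_mem _).2 fun k _ => hW1 k
      · rw [Filter.eventually_all_finset]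
        intro k hk
        filter_upwards [hW2 k] with n hn h
        exact hn (Set.mem_iInter₂.1 h k hk)
    obtain ⟨W, hW1, hW2⟩ := hW
    have hV : (fun y : ℝ => y⁻¹) ⁻¹' (W ∩ Set.Ioi (z⁻¹ / 2)) ∈ 𝓝 z :=
      (continuousAt_inv₀ hz.ne') (Filter.inter_mem hW1 (Ioi_mem_nhds (by linarith)))
    have h1 := hUle (zero_near ν hν z hFz (hsimple z hz hFz) _ hV)
    obtain ⟨n, hn1, hn2⟩ := (hW2.and h1).exists
    obtain ⟨y, hyV, hy0⟩ := hn2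
    obtain ⟨k, hk⟩ := s2 n y hy0
    have hyV' : y⁻¹ ∈ W ∧ z⁻¹ / 2 < y⁻¹ := hyV
    rw [← hk] at hyV'
    by_cases hkN : k < N
    · exact hn1 k (by simpa using hkN) hyV'.1
    · exact absurd (hbig n k (by omega)) (not_le.2 hyV'.2)
  · intro j k hk hjk
    by_contra hne
    have hk' : 0 < (t k)⁻¹ := inv_pos.2 (lt_of_le_of_ne (t0 k) (Ne.symm hk))
    have hj : t j ≠ 0 := hjk ▸ hk
    have r1 : Tendsto (fun n => (s n k)⁻¹) U (𝓝 (t k)⁻¹) := (ht k).inv₀ hk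
    have r2 : Tendsto (fun n => (s n j)⁻¹) U (𝓝 (t k)⁻¹) := hjk ▸ (ht j).inv₀ hj
    have hex : ∀ n, ∃ ξ, s n k ≠ 0 ∧ s n j ≠ 0 →
        ξ ∈ Set.uIcc (s n k)⁻¹ (s n j)⁻¹ ∧ (P ν n).derivative.eval ξ = 0 := by
      intro n
      by_cases h : s n k ≠ 0 ∧ s n j ≠ 0
      · have hne' : (s n k)⁻¹ ≠ (s n j)⁻¹ := by
          intro h'
          exact hne (s3 n j k h.1 (inv_injective h').symm)
        have key : ∀ x y : ℝ, x < y → (P ν n).eval x = 0 → (P ν n).eval y = 0 →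
            ∃ ξ ∈ Set.Ioo x y, (P ν n).derivative.eval ξ = 0 := fun x y hxy hx hy =>
          exists_hasDerivAt_eq_zero hxy (P ν n).continuous.continuousOn (by rw [hx, hy])
            (fun ξ _ => (P ν n).hasDerivAt ξ)
        rcases lt_or_gt_of_ne hne' with hl | hl
        · obtain ⟨ξ, hξ, h0⟩ := key _ _ hl (s1 n k h.1) (s1 n j h.2)
          exact ⟨ξ, fun _ => ⟨Set.Icc_subset_uIcc (Set.Ioo_subset_Icc_self hξ), h0⟩⟩
        · obtain ⟨ξ, hξ, h0⟩ := key _ _ hl (s1 n j h.2) (s1 n k h.1)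
          exact ⟨ξ, fun _ => ⟨Set.Icc_subset_uIcc' (Set.Ioo_subset_Icc_self hξ), h0⟩⟩
      · exact ⟨0, fun h' => absurd h' h⟩
    choose ξ hξ using hex
    have hev : ∀ᶠ n in (U : Filter ℕ), s n k ≠ 0 ∧ s n j ≠ 0 :=
      ((ht k).eventually_ne hk).and ((ht j).eventually_ne hj)
    have hξt : Tendsto ξ U (𝓝 (t k)⁻¹) := by
      have m1 := r1.min r2
      have m2 := r1.max r2
      rw [min_self] at m1
      rw [max_self] at m2
      refine tendsto_of_tendsto_of_tendsto_of_le_of_le' m1 m2 ?_ ?_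
      · filter_upwards [hev] with n hn
        exact (hξ n hn).1.1
      · filter_upwards [hev] with n hn
        exact (hξ n hn).1.2
    have h1 := P_deriv_conv ν hν U hUle _ _ hξt
    refine hsimple _ hk' (tz k hk) (tendsto_nhds_unique h1 (tendsto_const_nhds.congr' ?_))
    filter_upwards [hev] with n hn
    exact (hξ n hn).2.symm
  · have hst : Summable (fun k => t k ^ 3) :=
      Summable.of_nonneg_of_le (fun k => pow_nonneg (t0 k) 3)
        (fun k => pow_le_pow_left₀ (t0 k) (t4 k) 3) hsb
    have h1 : Tendsto (fun n => ∑' k, s n k ^ 3) U (𝓝 (∑' k, t k ^ 3)) := by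
      refine tendsto_tsum_of_dominated_convergence hsb (fun k => (ht k).pow 3) ?_
      refine Filter.Eventually.of_forall fun n k => ?_
      rw [Real.norm_of_nonneg (pow_nonneg (s0 n k) 3)]
      exact pow_le_pow_left₀ (s0 n k) (s4 n k) 3
    have h2 : Tendsto (fun n => ∑' k, s n k ^ 3) U (𝓝 (p3 ν)) := by
      simp only [s5]
      have hw : ∀ k, Tendsto (fun n => c ν k * w n k / c ν 0) U (𝓝 (c ν k / c ν 0)) := by
        intro k
        simpa using (((w_tend k).mono_left hUle).const_mul (c ν k)).div_const (c ν 0)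
      exact ((((hw 1).pow 3).neg).add (((hw 1).const_mul 3).mul (hw 2))).sub ((hw 3).const_mul 3)
    rw [tendsto_nhds_unique h2 h1]
    exact hst.hasSum

lemma p3_eq (ν : ℝ) (hν : 0 < ν) : p3 ν = 16 * ((ν ^ 3 + 16 * ν ^ 2 + 38 * ν + 24) /
        (16 * ν ^ 3 * (ν + 1) ^ 3 * (ν + 2) * (ν + 3))) * 2 := by
  have hG := (Real.Gamma_pos_of_pos (by positivity : 0 < ν + 1)).ne'
  have g1 : Real.Gamma (ν + 1 + 1) = (ν + 1) * Real.Gamma (ν + 1) :=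
    Real.Gamma_add_one (by positivity)
  have g2 : Real.Gamma (ν + 2 + 1) = (ν + 2) * ((ν + 1) * Real.Gamma (ν + 1)) := by
    rw [Real.Gamma_add_one (by positivity), ← g1]; ring_nf
  have g3 : Real.Gamma (ν + 3 + 1) =
      (ν + 3) * ((ν + 2) * ((ν + 1) * Real.Gamma (ν + 1))) := by
    rw [Real.Gamma_add_one (by positivity), ← g2]; ring_nf
  have c0 : c ν 0 = ν / Real.Gamma (ν + 1) := by simp [c]
  have c1 : c ν 1 = -(ν + 2) / ((ν + 1) * Real.Gamma (ν + 1)) := by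
    simp only [c]; push_cast; rw [g1]; norm_num; ring
  have c2 : c ν 2 = (ν + 4) / (2 * ((ν + 2) * ((ν + 1) * Real.Gamma (ν + 1)))) := by
    simp only [c]; push_cast; rw [g2]; norm_num [Nat.factorial]; ring
  have c3 : c ν 3 = -(ν + 6) / (6 * ((ν + 3) * ((ν + 2) * ((ν + 1) * Real.Gamma (ν + 1))))) := by
    simp only [c]; push_cast; rw [g3]; norm_num [Nat.factorial]; ring
  rw [p3, c0, c1, c2, c3]
  field_simp
  ring

end RS

/-- Rayleigh-type sum: `σ'_ν(6) = (ν³+16ν²+38ν+24)/(16ν³(ν+1)³(ν+2)(ν+3))`. -/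
theorem rayleigh_sum_six (ν : ℝ) (hν : 0 < ν) (jz : ℤ → ℝ)
    (hjz : IsBesselDerivZeros ν jz) :
    ∑' k : {z : ℤ // z ≠ 0}, 1 / (jz k) ^ 6 =
      (ν ^ 3 + 16 * ν ^ 2 + 38 * ν + 24) /
        (16 * ν ^ 3 * (ν + 1) ^ 3 * (ν + 2) * (ν + 3)) := by
  have hsq : ∀ k : ℤ, 1 ≤ k → 0 < jz k := fun k hk => hν.trans (hjz.gt_nu k hk)
  have hsimple : ∀ y, 0 < y → RS.E (RS.c ν) y = 0 → RS.E (RS.D (RS.c ν)) y ≠ 0 := by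
    intro y hy h0
    refine RS.F_simple ν hν y hy ?_ h0
    have hx : 0 < 2 * Real.sqrt y := by positivity
    have hxy : (2 * Real.sqrt y) ^ 2 / 4 = y := by
      rw [mul_pow, Real.sq_sqrt hy.le]; ring
    obtain ⟨k, hk, hk2⟩ := hjz.complete _ hx
      ((RS.bessel_zero_iff ν hν _ hx).2 (by rw [hxy]; exact h0))
    have h1 := hjz.gt_nu k hk
    rw [hk2] at h1
    have h2 : ν ^ 2 < (2 * Real.sqrt y) ^ 2 := by gcongr
    intro h3
    linarith
  obtain ⟨t, t0, t1, t2, t3, t4⟩ := RS.main_limit ν hν hsimple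
  have hpos : ∀ m : ℕ, 0 < jz (m + 1) := fun m => hsq _ (by omega)
  have hz : ∀ m : ℕ, RS.E (RS.c ν) (jz (m + 1) ^ 2 / 4) = 0 := fun m =>
    (RS.bessel_zero_iff ν hν _ (hpos m)).1 (hjz.is_zero _ (by omega))
  have hinj : ∀ m m' : ℕ, jz (m + 1) = jz (m' + 1) → m = m' := by
    intro m m' h
    rcases lt_trichotomy m m' with h' | h' | h'
    · exact absurd h (hjz.mono _ _ (by omega) (by omega)).ne
    · exact h'
    · exact absurd h (hjz.mono _ _ (by omega) (by omega)).ne'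
  have hex : ∀ m : ℕ, ∃ k, t k = (jz (m + 1) ^ 2 / 4)⁻¹ := fun m =>
    t2 _ (by have := hpos m; positivity) (hz m)
  choose i hi using hex
  have hsum : HasSum (fun m : ℕ => ((jz (m + 1) ^ 2 / 4)⁻¹) ^ 3) (RS.p3 ν) := by
    refine (hasSum_iff_hasSum_of_ne_zero_bij
      (f := fun k => t k ^ 3) (fun x => i x.1) ?_ ?_ ?_).1 t4
    · intro x y hxy
      have h1 : (jz (x.1 + 1) ^ 2 / 4)⁻¹ = (jz (y.1 + 1) ^ 2 / 4)⁻¹ := by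
        rw [← hi, ← hi]; exact congrArg t hxy
      have h2 : jz (x.1 + 1) ^ 2 = jz (y.1 + 1) ^ 2 := by
        have := inv_injective h1
        linarith
      exact Subtype.ext (hinj _ _ ((pow_left_inj₀ (hpos _).le (hpos _).le two_ne_zero).1 h2))
    · intro k hk
      have hk0 : t k ≠ 0 := by
        intro h; apply hk; simp [h]
      have hkp : 0 < t k := lt_of_le_of_ne (t0 k) (Ne.symm hk0)
      have hx : 0 < 2 * Real.sqrt (t k)⁻¹ := by positivity
      have hxy : (2 * Real.sqrt (t k)⁻¹) ^ 2 / 4 = (t k)⁻¹ := by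
        rw [mul_pow, Real.sq_sqrt (by positivity)]; ring
      obtain ⟨l, hl, hl2⟩ := hjz.complete _ hx
        ((RS.bessel_zero_iff ν hν _ hx).2 (by rw [hxy]; exact t1 k hk0))
      obtain ⟨m, rfl⟩ : ∃ m : ℕ, l = m + 1 := ⟨(l - 1).toNat, by omega⟩
      have h1 : t (i m) = t k := by rw [hi, hl2, hxy, inv_inv]
      refine ⟨⟨m, ?_⟩, t3 _ _ hk0 h1⟩
      rw [Function.mem_support, ← hi, h1]
      positivity
    · intro x
      simp only [hi]
  have hsum2 : HasSum (fun m : ℕ => 1 / jz (m + 1) ^ 6) (RS.p3 ν / 64) := by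
    refine (hsum.div_const 64).congr_fun ?_ 
    intro m
    have := (hpos m).ne'
    field_simp
    norm_num
  have hj0 : jz 0 = 0 := by
    have := hjz.odd_sym 0
    rw [neg_zero] at this
    linarith
  have hA : HasSum (fun n : ℕ => 1 / jz (n : ℤ) ^ 6) (RS.p3 ν / 64) := by
    rw [← hasSum_nat_add_iff' 1]
    simpa [hj0] using hsum2
  have hB : HasSum (fun n : ℕ => 1 / jz (-((n : ℤ) + 1)) ^ 6) (RS.p3 ν / 64) := by
    refine hsum2.congr_fun ?_
    intro n
    rw [hjz.odd_sym, Even.neg_pow (by decide)]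
  have hall : HasSum (fun k : ℤ => 1 / jz k ^ 6) (RS.p3 ν / 64 + RS.p3 ν / 64) :=
    HasSum.of_nat_of_neg_add_one hA hB
  have hsub := (hasSum_subtype_iff_of_support_subset (f := fun k : ℤ => 1 / jz k ^ 6)
    (s := {z : ℤ | z ≠ 0}) (by
      intro k hk h0
      apply hk
      have : k = 0 := h0
      simp [this, hj0])).2 hall
  refine hsub.tsum_eq.trans ?_
  rw [RS.p3_eq ν hν]
  ring
end

section
/- Let p_{n,ν} be the monic orthogonal polynomials (with respect to the moment functional L with moments μ_n = σ'_ν(n+2)). Then for ν > 0 and n ≥ 0, p_{n,ν}(x)·(x² − ν^{−2})·q_{n,ν}(1/ν)/2 = q_{n,ν}(1/ν)·q_{n+2,ν}(x) − q_{n,ν}(x)·q_{n+2,ν}(1/ν), where q_{n,ν} are defined by the recurrence q_{n+1,ν}(x) = x·q_{n,ν}(x) − q_{n−1,ν}(x)/(4(ν+n−1)(ν+n)), q_{0,ν}=1, q_{1,ν}(x)=x/2. -/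
open Finset

/-- The polynomials `q_{n,ν}` defined by `q_0 = 1`, `q_1(x) = x/2`, and
`q_{n+1}(x) = x q_n(x) - q_{n-1}(x)/(4(ν+n-1)(ν+n))`. -/
noncomputable def qpoly (ν : ℝ) : ℕ → ℝ → ℝ
  | 0, _ => 1
  | 1, x => x / 2
  | n + 2, x => x * qpoly ν (n + 1) x - (1 / (4 * (ν + n) * (ν + n + 1))) * qpoly ν n x

open Filter Topology

/-- The Hilbert space of square summable real sequences. -/
abbrev HSeq : Type := lp (fun _ : ℕ => ℝ) 2

theorem hseq_hasSum_sq (v : HSeq) : HasSum (fun n => (v n) ^ 2) (‖v‖ ^ 2) := by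
  have h := lp.hasSum_inner (𝕜 := ℝ) v v
  rw [real_inner_self_eq_norm_sq] at h
  simpa [sq] using h

theorem hseq_mem {f : ℕ → ℝ} (h : Summable fun n => (f n) ^ 2) :
    Memℓp (E := fun _ : ℕ => ℝ) f 2 := by
  apply memℓp_gen
  simpa using h

theorem hseq_exists_op (L : (ℕ → ℝ) →ₗ[ℝ] (ℕ → ℝ)) (K : ℝ) (hK : 0 ≤ K)
    (hs : ∀ v : HSeq, Summable fun n => (L v n) ^ 2)
    (hb : ∀ v : HSeq, ∑' n, (L v n) ^ 2 ≤ K ^ 2 * ‖v‖ ^ 2) :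
    ∃ D : HSeq →L[ℝ] HSeq, (∀ v n, D v n = L v n) ∧ ‖D‖ ≤ K := by
  let f : HSeq →ₗ[ℝ] HSeq :=
    { toFun := fun v => ⟨L v, hseq_mem (hs v)⟩
      map_add' := by
        intro x y
        ext n
        show L (⇑x + ⇑y) n = L x n + L y n
        rw [map_add, Pi.add_apply]
      map_smul' := by
        intro x y
        ext n
        simp }
  have hf : ∀ v, ‖f v‖ ≤ K * ‖v‖ := by
    intro v
    have h1 := (hseq_hasSum_sq (f v)).tsum_eq
    have h2 := hb v
    have h3 : ∑' n, (f v n) ^ 2 = ∑' n, (L v n) ^ 2 := rfl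
    rw [← abs_of_nonneg (norm_nonneg (f v)), ← abs_of_nonneg (mul_nonneg hK (norm_nonneg v))]
    apply sq_le_sq.mp
    rw [mul_pow]
    linarith
  exact ⟨f.mkContinuous K hf, fun v n => rfl, f.mkContinuous_norm_le hK hf⟩

theorem hseq_exists_diag (c : ℕ → ℝ) (K : ℝ) (hK : ∀ n, |c n| ≤ K) :
    ∃ D : HSeq →L[ℝ] HSeq, (∀ v n, D v n = c n * v n) ∧ ‖D‖ ≤ K := by
  have hK0 : 0 ≤ K := (abs_nonneg _).trans (hK 0)
  let L : (ℕ → ℝ) →ₗ[ℝ] (ℕ → ℝ) :=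
    { toFun := fun v n => c n * v n
      map_add' := by intro x y; ext n; simp [mul_add]
      map_smul' := by intro x y; ext n; simp; ring }
  have hle : ∀ (v : HSeq) n, (c n * v n) ^ 2 ≤ K ^ 2 * (v n) ^ 2 := by
    intro v n
    rw [mul_pow]
    have : (c n) ^ 2 ≤ K ^ 2 := by
      rw [← sq_abs]
      exact pow_le_pow_left₀ (abs_nonneg _) (hK n) 2
    exact mul_le_mul_of_nonneg_right this (sq_nonneg _)
  have hs : ∀ v : HSeq, Summable fun n => (c n * v n) ^ 2 := fun v =>
    Summable.of_nonneg_of_le (fun n => sq_nonneg _) (hle v)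
      ((hseq_hasSum_sq v).summable.mul_left _)
  refine hseq_exists_op L K hK0 hs ?_
  intro v
  have h1 := (hseq_hasSum_sq v).mul_left (K ^ 2)
  exact hasSum_le (hle v) (hs v).hasSum h1

theorem hseq_exists_compact_diag (c : ℕ → ℝ) (hc : Tendsto c atTop (𝓝 0)) :
    ∃ D : HSeq →L[ℝ] HSeq, (∀ v n, D v n = c n * v n) ∧ IsCompactOperator D := by
  obtain ⟨K, hK⟩ : ∃ K, ∀ n, |c n| ≤ K := by
    obtain ⟨K, hK⟩ := (hc.abs).bddAbove_range
    exact ⟨K, fun n => hK ⟨n, rfl⟩⟩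
  obtain ⟨D, hD, -⟩ := hseq_exists_diag c K hK
  refine ⟨D, hD, ?_⟩
  let P : ℕ → (HSeq →L[ℝ] HSeq) := fun i =>
    (lp.evalCLM ℝ (fun _ : ℕ => ℝ) 2 i).smulRight (lp.single 2 i (c i) : HSeq)
  have hP : ∀ i, IsCompactOperator (P i) := by
    intro i
    let ev : HSeq →L[ℝ] ℝ := lp.evalCLM ℝ (fun _ : ℕ => ℝ) 2 i
    have h1 : IsCompactOperator ev := isCompactOperator_of_locallyCompactSpace_dom ev
    exact h1.clm_comp (ContinuousLinearMap.toSpanSingleton ℝ (lp.single 2 i (c i) : HSeq))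
  let S : ℕ → (HSeq →L[ℝ] HSeq) := fun N => ∑ i ∈ range N, P i
  have hS : ∀ N, IsCompactOperator (S N) := by
    intro N
    induction N with
    | zero =>
      have : S 0 = 0 := by simp [S]
      rw [this]
      exact isCompactOperator_zero
    | succ N ih =>
      have : S (N + 1) = S N + P N := by simp [S, sum_range_succ]
      rw [this]
      exact ih.add (hP N)
  have hSv : ∀ N v n, S N v n = if n < N then c n * v n else 0 := by
    intro N v n
    induction N with
    | zero => simp [S]
    | succ N ih =>
      have : S (N + 1) = S N + P N := by simp [S, sum_range_succ]
      rw [this, _root_.add_apply, lp.coeFn_add, Pi.add_apply, ih]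
      have h2 : P N v n = if n = N then c n * v n else 0 := by
        show (v N • (lp.single 2 N (c N) : HSeq)) n = _
        rw [lp.coeFn_smul, Pi.smul_apply, lp.single_apply]
        by_cases h : n = N
        · subst h; simp [mul_comm]
        · simp [h]
      rw [h2]
      by_cases h : n = N
      · subst h; simp
      · have : n < N + 1 ↔ n < N := by omega
        simp [h, this]
  refine isCompactOperator_of_tendsto (F := S) (l := atTop) ?_ (Eventually.of_forall hS)
  rw [Metric.tendsto_atTop]
  intro ε hε
  rw [Metric.tendsto_atTop] at hc
  obtain ⟨N, hN⟩ := hc (ε / 2) (by positivity)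
  refine ⟨N, fun M hM => ?_⟩
  obtain ⟨E, hE, hEn⟩ := hseq_exists_diag (fun n => if n < M then 0 else c n) (ε / 2) (by
    intro n
    by_cases h : n < M
    · simp [h]; positivity
    · simp only [h, if_false]
      have := hN n (by omega)
      simp only [Real.dist_eq, sub_zero] at this
      exact this.le)
  have : D - S M = E := by
    ext v n
    rw [_root_.sub_apply, lp.coeFn_sub, Pi.sub_apply, hD, hSv, hE]
    by_cases h : n < M <;> simp [h]
  rw [dist_comm, dist_eq_norm, this]
  linarith

theorem hseq_exists_shift :
    ∃ R : HSeq →L[ℝ] HSeq, (∀ v, R v 0 = 0) ∧ ∀ v n, R v (n + 1) = v n := by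
  let L : (ℕ → ℝ) →ₗ[ℝ] (ℕ → ℝ) :=
    { toFun := fun v n => Nat.casesOn n 0 v
      map_add' := by intro x y; ext n; cases n <;> simp
      map_smul' := by intro x y; ext n; cases n <;> simp }
  have h0 : ∀ v : ℕ → ℝ, L v 0 = 0 := fun v => rfl
  have h1 : ∀ (v : ℕ → ℝ) n, L v (n + 1) = v n := fun v n => rfl
  have hs : ∀ v : HSeq, HasSum (fun n => (L v n) ^ 2) (‖v‖ ^ 2) := by
    intro v
    rw [← hasSum_nat_add_iff' 1]
    simpa [h0, h1] using hseq_hasSum_sq v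
  obtain ⟨R, hR, -⟩ := hseq_exists_op L 1 zero_le_one (fun v => (hs v).summable)
    (fun v => by rw [(hs v).tsum_eq]; simp)
  exact ⟨R, fun v => by rw [hR, h0], fun v n => by rw [hR, h1]⟩

theorem hseq_exists_jacobi (c : ℕ → ℝ) (hc : Tendsto c atTop (𝓝 0)) :
    ∃ T : HSeq →L[ℝ] HSeq, IsCompactOperator T ∧ (T : HSeq →ₗ[ℝ] HSeq).IsSymmetric ∧
      (∀ v, T v 0 = c 0 * (c 1 * v 1)) ∧
      ∀ v n, T v (n + 1) = c (n + 1) * (c n * v n + c (n + 2) * v (n + 2)) := by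
  obtain ⟨D, hD, hDc⟩ := hseq_exists_compact_diag c hc
  obtain ⟨R, hR0, hR1⟩ := hseq_exists_shift
  have hDs : ∀ x y : HSeq, inner ℝ (D x) y = inner ℝ x (D y) := by
    intro x y
    rw [lp.inner_eq_tsum, lp.inner_eq_tsum]
    refine tsum_congr fun n => ?_
    rw [hD, hD]
    simp
    ring
  have hadj : ∀ v n, (ContinuousLinearMap.adjoint R v) n = v (n + 1) := by
    intro v n
    have h1 : inner ℝ (lp.single 2 n (1 : ℝ) : HSeq) (ContinuousLinearMap.adjoint R v) =
        inner ℝ (R (lp.single 2 n (1 : ℝ) : HSeq)) v :=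
      ContinuousLinearMap.adjoint_inner_right R _ _
    have h2 : R (lp.single 2 n (1 : ℝ) : HSeq) = (lp.single 2 (n + 1) (1 : ℝ) : HSeq) := by
      ext k
      cases k with
      | zero => rw [hR0, lp.single_apply_ne]; omega
      | succ k =>
        rw [hR1]
        by_cases h : k = n
        · subst h; simp
        · rw [lp.single_apply_ne _ _ _ h, lp.single_apply_ne]; omega
    rw [h2, lp.inner_single_left, lp.inner_single_left] at h1
    simpa using h1
  refine ⟨D ∘L (R + ContinuousLinearMap.adjoint R) ∘L D, ?_, ?_, ?_, ?_⟩
  · exact (hDc.clm_comp (R + ContinuousLinearMap.adjoint R)).clm_comp D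
  · intro x y
    show inner ℝ (D ((R + ContinuousLinearMap.adjoint R) (D x))) y =
      inner ℝ x (D ((R + ContinuousLinearMap.adjoint R) (D y)))
    rw [hDs, ← hDs x, _root_.add_apply, _root_.add_apply,
      inner_add_left, inner_add_right, ContinuousLinearMap.adjoint_inner_left,
      ContinuousLinearMap.adjoint_inner_right]
    ring
  · intro v
    show (D ((R + ContinuousLinearMap.adjoint R) (D v))) 0 = _
    rw [hD, _root_.add_apply, lp.coeFn_add, Pi.add_apply, hR0, hadj, hD]
    ring
  · intro v n
    show (D ((R + ContinuousLinearMap.adjoint R) (D v))) (n + 1) = _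
    rw [hD, _root_.add_apply, lp.coeFn_add, Pi.add_apply, hR1, hadj, hD, hD]
/-- The `k`-th term of the entire part of the Bessel function. -/
noncomputable def besT (μ x : ℝ) (k : ℕ) : ℝ :=
  ((-1) ^ k / (k.factorial * Real.Gamma (μ + k + 1))) * (x / 2) ^ (2 * k)

/-- The entire part of the Bessel function. -/
noncomputable def besE (μ x : ℝ) : ℝ := ∑' k : ℕ, besT μ x k

theorem besselJ_eq (μ x : ℝ) : besselJ μ x = besE μ x * (x / 2) ^ μ := by
  unfold besselJ besE besT
  rw [tsum_mul_right]

theorem gamma_le_add {μ : ℝ} (hμ : 0 < μ) (k : ℕ) :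
    Real.Gamma (μ + 1) ≤ Real.Gamma (μ + k + 1) := by
  induction k with
  | zero => simp
  | succ k ih =>
    have hp : 0 < μ + k + 1 := by positivity
    have h1 : Real.Gamma (μ + (k + 1 : ℕ) + 1) = (μ + k + 1) * Real.Gamma (μ + k + 1) := by
      rw [← Real.Gamma_add_one hp.ne']
      push_cast
      ring_nf
    rw [h1]
    have h2 := Real.Gamma_pos_of_pos hp
    have h3 : (0 : ℝ) ≤ k := Nat.cast_nonneg k
    nlinarith

theorem gamma_fact_le {μ : ℝ} (hμ : 0 < μ) (k : ℕ) :
    k.factorial * Real.Gamma (μ + 1) ≤ Real.Gamma (μ + k + 1) := by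
  induction k with
  | zero => simp
  | succ k ih =>
    have hp : 0 < μ + k + 1 := by positivity
    have h1 : Real.Gamma (μ + (k + 1 : ℕ) + 1) = (μ + k + 1) * Real.Gamma (μ + k + 1) := by
      rw [← Real.Gamma_add_one hp.ne']
      push_cast
      ring_nf
    rw [h1, Nat.factorial_succ]
    push_cast
    have h2 := Real.Gamma_pos_of_pos hp
    have h3 : (0 : ℝ) ≤ k := Nat.cast_nonneg k
    calc ((k : ℝ) + 1) * k.factorial * Real.Gamma (μ + 1)
        = ((k : ℝ) + 1) * (k.factorial * Real.Gamma (μ + 1)) := by ring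
      _ ≤ ((k : ℝ) + 1) * Real.Gamma (μ + k + 1) := by gcongr
      _ ≤ _ := by gcongr; linarith

theorem besT_bound {μ : ℝ} (hμ : 0 < μ) (x : ℝ) (k : ℕ) :
    |besT μ x k| ≤ (1 / Real.Gamma (μ + 1)) * (((x / 2) ^ 2) ^ k / k.factorial) := by
  have h1 := gamma_le_add hμ k
  have h2 : 0 < Real.Gamma (μ + 1) := Real.Gamma_pos_of_pos (by positivity)
  have h3 : 0 < Real.Gamma (μ + k + 1) := h2.trans_le h1
  have hf : (0 : ℝ) < k.factorial := by positivity
  unfold besT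
  rw [abs_mul, abs_div, abs_pow, abs_neg, abs_one, one_pow, pow_mul,
    abs_of_pos (mul_pos hf h3), abs_of_nonneg (by positivity : 0 ≤ ((x / 2) ^ 2) ^ k)]
  calc 1 / (k.factorial * Real.Gamma (μ + k + 1)) * ((x / 2) ^ 2) ^ k
      ≤ 1 / (k.factorial * Real.Gamma (μ + 1)) * ((x / 2) ^ 2) ^ k := by gcongr
    _ = _ := by field_simp

theorem besT_summable {μ : ℝ} (hμ : 0 < μ) (x : ℝ) : Summable (besT μ x) := by
  exact Summable.of_norm_bounded ((Real.summable_pow_div_factorial _).mul_left _)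
    (besT_bound hμ x)

theorem besE_bound {μ : ℝ} (hμ : 0 < μ) (x : ℝ) :
    |besE μ x| ≤ (1 / Real.Gamma (μ + 1)) * Real.exp ((x / 2) ^ 2) := by
  have hs : HasSum (fun k : ℕ => (1 / Real.Gamma (μ + 1)) * (((x / 2) ^ 2) ^ k / k.factorial))
      ((1 / Real.Gamma (μ + 1)) * Real.exp ((x / 2) ^ 2)) := by
    apply HasSum.mul_left
    rw [Real.exp_eq_exp_ℝ]
    exact NormedSpace.expSeries_div_hasSum_exp _
  have := tsum_of_norm_bounded hs (f := besT μ x)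
    (fun k => by rw [Real.norm_eq_abs]; exact besT_bound hμ x k)
  simpa [besE] using this

theorem besT_zero (μ x : ℝ) : besT μ x 0 = 1 / Real.Gamma (μ + 1) := by
  simp [besT]

theorem gamma_shift {μ : ℝ} (hμ : 0 < μ) (k : ℕ) :
    Real.Gamma (μ + k + 2) = (μ + k + 1) * Real.Gamma (μ + k + 1) := by
  have hp : 0 < μ + k + 1 := by positivity
  rw [← Real.Gamma_add_one hp.ne']
  ring_nf

theorem besE_rec {μ : ℝ} (hμ : 0 < μ) (x : ℝ) :
    besE μ x + (x / 2) ^ 2 * besE (μ + 2) x = (μ + 1) * besE (μ + 1) x := by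
  have h0 := besT_summable hμ x
  have h1 := besT_summable (by linarith : 0 < μ + 1) x
  have h2 := besT_summable (by linarith : 0 < μ + 2) x
  unfold besE
  rw [h0.tsum_eq_zero_add, h1.tsum_eq_zero_add, mul_add, ← tsum_mul_left, ← tsum_mul_left,
    add_assoc, ← ((summable_nat_add_iff 1).mpr h0).tsum_add (h2.mul_left _)]
  have hG := Real.Gamma_pos_of_pos (by linarith : 0 < μ + 1)
  congr 1
  · rw [besT_zero, besT_zero, Real.Gamma_add_one (by positivity : μ + 1 ≠ 0)]
    field_simp
  · refine tsum_congr fun k => ?_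
    unfold besT
    have hk := Real.Gamma_pos_of_pos (by positivity : 0 < μ + k + 2)
    have e1 : μ + (k + 1 : ℕ) + 1 = μ + k + 2 := by push_cast; ring
    have e2 : μ + 2 + k + 1 = (μ + k + 2) + 1 := by ring
    have e3 : μ + 1 + (k + 1 : ℕ) + 1 = (μ + k + 2) + 1 := by push_cast; ring
    rw [e1, e2, e3, Real.Gamma_add_one (by positivity : μ + k + 2 ≠ 0), Nat.factorial_succ]
    have hf : (0 : ℝ) < k.factorial := by positivity
    have hp : 0 < μ + k + 2 := by positivity
    have hk1 : (0 : ℝ) < k + 1 := by positivity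
    push_cast
    field_simp
    ring

theorem besE_hasDerivAt {μ : ℝ} (hμ : 0 < μ) (x : ℝ) :
    HasDerivAt (fun y => besE μ y) (-(x / 2) * besE (μ + 1) x) x := by
  let c : ℕ → ℝ := fun k => (-1) ^ k / (k.factorial * Real.Gamma (μ + k + 1))
  let g' : ℕ → ℝ → ℝ := fun k y => c k * ((2 * k : ℕ) * (y / 2) ^ (2 * k - 1) * (1 / 2))
  have hg0 : ∀ y, g' 0 y = 0 := by intro y; simp [g']
  have hg1 : ∀ k y, g' (k + 1) y = -(y / 2) * besT (μ + 1) y k := by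
    intro k y
    have e1 : 2 * (k + 1) - 1 = 2 * k + 1 := by omega
    have e2 : μ + (k + 1 : ℕ) + 1 = μ + 1 + k + 1 := by push_cast; ring
    have hf : (0 : ℝ) < k.factorial := by positivity
    have hk1 : (0 : ℝ) < k + 1 := by positivity
    have hk := Real.Gamma_pos_of_pos (by positivity : 0 < μ + 1 + k + 1)
    simp only [g', c, besT]
    rw [e1, e2, Nat.factorial_succ]
    push_cast
    field_simp
    ring
  let r : ℝ := |x| + 1
  let u : ℕ → ℝ := fun k => Nat.casesOn k 0
    fun j => (r / 2) * ((1 / Real.Gamma (μ + 1 + 1)) * (((r / 2) ^ 2) ^ j / j.factorial))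
  have hu : Summable u := by
    rw [← summable_nat_add_iff 1]
    exact ((Real.summable_pow_div_factorial _).mul_left _).mul_left _
  have hμ1 : 0 < μ + 1 := by linarith
  have key := hasDerivAt_tsum_of_isPreconnected (g := fun k y => besT μ y k) (g' := g') (u := u)
    (t := Set.Ioo (-r) r) (y₀ := x) (y := x) hu isOpen_Ioo isPreconnected_Ioo
    (by
      intro k y _
      have h1 : HasDerivAt (fun y : ℝ => y / 2) (1 / 2) y := (hasDerivAt_id y).div_const 2
      exact (h1.pow (2 * k)).const_mul (c k))
    (by
      intro k y hy
      have hy' : |y| ≤ r := abs_le.mpr ⟨hy.1.le, hy.2.le⟩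
      have hr : 0 ≤ r := by positivity
      cases k with
      | zero => rw [hg0]; simp [u]
      | succ k =>
        rw [hg1, norm_mul, Real.norm_eq_abs, Real.norm_eq_abs, abs_neg, abs_div,
          abs_of_pos (by norm_num : (0 : ℝ) < 2)]
        have hb := besT_bound hμ1 y k
        have hG := Real.Gamma_pos_of_pos (by linarith : 0 < μ + 1 + 1)
        have h2 : (y / 2) ^ 2 ≤ (r / 2) ^ 2 := by
          apply sq_le_sq.mpr
          rw [abs_div, abs_div, abs_of_nonneg hr]
          gcongr
        show |y| / 2 * |besT (μ + 1) y k| ≤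
          (r / 2) * ((1 / Real.Gamma (μ + 1 + 1)) * (((r / 2) ^ 2) ^ k / k.factorial))
        refine mul_le_mul (by gcongr) (hb.trans ?_) (abs_nonneg _) (by positivity)
        gcongr)
    (by constructor <;> simp only [r] <;> linarith [neg_abs_le x, le_abs_self x])
    (besT_summable hμ x)
    (by constructor <;> simp only [r] <;> linarith [neg_abs_le x, le_abs_self x])
  have hsum : ∑' k, g' k x = -(x / 2) * besE (μ + 1) x := by
    have hs : Summable fun k => g' k x := by
      rw [← summable_nat_add_iff 1]
      simp only [hg1]
      exact (besT_summable hμ1 x).mul_left _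
    rw [hs.tsum_eq_zero_add, hg0, zero_add]
    simp only [hg1]
    rw [tsum_mul_left]
    rfl
  rw [← hsum]
  exact key

theorem besselJ_rec {μ : ℝ} (hμ : 0 < μ) {x : ℝ} (hx : 0 < x) :
    besselJ μ x + besselJ (μ + 2) x = 2 * (μ + 1) / x * besselJ (μ + 1) x := by
  have h := besE_rec hμ x
  have hx2 : 0 < x / 2 := by positivity
  rw [besselJ_eq, besselJ_eq, besselJ_eq, Real.rpow_add hx2, Real.rpow_add hx2, Real.rpow_one,
    Real.rpow_two]
  have : besE μ x * (x / 2) ^ μ + besE (μ + 2) x * ((x / 2) ^ μ * (x / 2) ^ 2) =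
    (besE μ x + (x / 2) ^ 2 * besE (μ + 2) x) * (x / 2) ^ μ := by ring
  rw [this, h]
  field_simp

theorem besselJ_deriv {μ : ℝ} (hμ : 0 < μ) {x : ℝ} (hx : 0 < x) :
    deriv (besselJ μ) x = μ / x * besselJ μ x - besselJ (μ + 1) x := by
  have hx2 : 0 < x / 2 := by positivity
  have h1 : HasDerivAt (fun y : ℝ => y / 2) (1 / 2) x := (hasDerivAt_id x).div_const 2
  have h2 := h1.rpow_const (p := μ) (Or.inl hx2.ne')
  have h3 := (besE_hasDerivAt hμ x).mul h2
  have h4 : besselJ μ = (fun y => besE μ y) * fun y : ℝ => (y / 2) ^ μ := by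
    ext y
    exact besselJ_eq μ y
  rw [h4, h3.deriv, ← h4, besselJ_eq, besselJ_eq, Real.rpow_add hx2, Real.rpow_one,
    Real.rpow_sub hx2, Real.rpow_one]
  field_simp
  ring

theorem besselJ_tendsto {ν : ℝ} (hν : 0 < ν) {x : ℝ} (hx : 0 < x) :
    Tendsto (fun n : ℕ => besselJ (ν + n) x) atTop (𝓝 0) := by
  have hx2 : 0 < x / 2 := by positivity
  have hG := Real.Gamma_pos_of_pos (by linarith : 0 < ν + 1)
  have hb : ∀ n : ℕ, ‖besselJ (ν + n) x‖ ≤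
      (1 / Real.Gamma (ν + 1) * Real.exp ((x / 2) ^ 2) * (x / 2) ^ ν) *
        ((x / 2) ^ n / n.factorial) := by
    intro n
    have hp : 0 < ν + n := by positivity
    have hf : (0 : ℝ) < n.factorial := by positivity
    have h1 := besE_bound hp x
    have h2 := gamma_fact_le hν n
    rw [besselJ_eq, norm_mul, Real.norm_eq_abs, Real.norm_eq_abs,
      abs_of_pos (Real.rpow_pos_of_pos hx2 _), Real.rpow_add hx2, Real.rpow_natCast]
    have h3 : 1 / Real.Gamma (ν + n + 1) ≤ 1 / (n.factorial * Real.Gamma (ν + 1)) :=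
      one_div_le_one_div_of_le (by positivity) h2
    calc |besE (ν + n) x| * ((x / 2) ^ ν * (x / 2) ^ n)
        ≤ (1 / Real.Gamma (ν + n + 1) * Real.exp ((x / 2) ^ 2)) *
          ((x / 2) ^ ν * (x / 2) ^ n) := by gcongr
      _ ≤ (1 / (n.factorial * Real.Gamma (ν + 1)) * Real.exp ((x / 2) ^ 2)) *
          ((x / 2) ^ ν * (x / 2) ^ n) := by gcongr
      _ = _ := by field_simp
  refine squeeze_zero_norm hb ?_
  have := (FloorSemiring.tendsto_pow_div_factorial_atTop (x / 2)).const_mul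
    (1 / Real.Gamma (ν + 1) * Real.exp ((x / 2) ^ 2) * (x / 2) ^ ν)
  simpa using this

theorem besselJ_exists_ne {ν : ℝ} (hν : 0 < ν) {x : ℝ} (hx : 0 < x) :
    ∃ n : ℕ, besselJ (ν + n) x ≠ 0 := by
  by_contra! hcon
  have hx2 : 0 < x / 2 := by positivity
  obtain ⟨n, hn⟩ := exists_nat_gt (Real.exp ((x / 2) ^ 2) * (x / 2) ^ 2)
  have hμ : 0 < ν + n := by positivity
  have hμ1 : 0 < ν + n + 1 := by positivity
  have h2 : ∀ m : ℕ, besE (ν + m) x = 0 := by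
    intro m
    have := hcon m
    rw [besselJ_eq] at this
    exact (mul_eq_zero.mp this).resolve_right (Real.rpow_pos_of_pos hx2 _).ne'
  have hs := besT_summable hμ x
  have h3 := h2 n
  unfold besE at h3
  rw [hs.tsum_eq_zero_add, besT_zero] at h3
  have hG := Real.Gamma_pos_of_pos hμ1
  set w := (x / 2) ^ 2 with hw
  have hw0 : 0 < w := by positivity
  have hbd : ∀ k, ‖besT (ν + n) x (k + 1)‖ ≤
      (w / Real.Gamma (ν + n + 1 + 1)) * (w ^ k / k.factorial) := by
    intro k
    have hb := besT_bound hμ1 x k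
    have hGk := Real.Gamma_pos_of_pos (by positivity : 0 < ν + n + 1 + k + 1)
    have e : besT (ν + n) x (k + 1) = -(w / (k + 1)) * besT (ν + n + 1) x k := by
      unfold besT
      have e1 : ν + n + (k + 1 : ℕ) + 1 = ν + n + 1 + k + 1 := by push_cast; ring
      have hf : (0 : ℝ) < k.factorial := by positivity
      have hk1 : (0 : ℝ) < k + 1 := by positivity
      rw [e1, Nat.factorial_succ, hw]
      push_cast
      field_simp
      ring
    rw [e, norm_mul, Real.norm_eq_abs, Real.norm_eq_abs, abs_neg, abs_of_nonneg (by positivity)]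
    have h5 : w / (k + 1) ≤ w := by
      apply div_le_self hw0.le
      have : (0 : ℝ) ≤ k := Nat.cast_nonneg k
      linarith
    calc w / (k + 1) * |besT (ν + n + 1) x k|
        ≤ w * (1 / Real.Gamma (ν + n + 1 + 1) * (w ^ k / k.factorial)) := by gcongr
      _ = _ := by ring
  have hexp : HasSum (fun k : ℕ => (w / Real.Gamma (ν + n + 1 + 1)) * (w ^ k / k.factorial))
      ((w / Real.Gamma (ν + n + 1 + 1)) * Real.exp w) := by
    apply HasSum.mul_left
    rw [Real.exp_eq_exp_ℝ]
    exact NormedSpace.expSeries_div_hasSum_exp _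
  have h6 := tsum_of_norm_bounded hexp hbd
  have h7 : ∑' k, besT (ν + n) x (k + 1) = -(1 / Real.Gamma (ν + n + 1)) := by linarith
  rw [h7, norm_neg, Real.norm_eq_abs, abs_of_pos (by positivity),
    Real.Gamma_add_one hμ1.ne', div_mul_eq_mul_div,
    div_le_div_iff₀ hG (by positivity)] at h6
  have : ν + n + 1 ≤ w * Real.exp w := by
    have h8 : (ν + n + 1) * Real.Gamma (ν + n + 1) ≤ (w * Real.exp w) * Real.Gamma (ν + n + 1) := by
      linarith
    exact le_of_mul_le_mul_right h8 hG
  linarith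
/-- Rescaled version of `qpoly`: the values `J_{ν+n}/J_ν` at the zeros of `J_ν'`. -/
noncomputable def besH (ν : ℝ) : ℕ → ℝ → ℝ
  | 0, _ => 1
  | 1, x => ν * x
  | n + 2, x => 2 * (ν + n + 1) * x * besH ν (n + 1) x - besH ν n x

/-- Weights of the Jacobi operator. -/
noncomputable def besW (ν : ℝ) : ℕ → ℝ
  | 0 => ν
  | n + 1 => 2 * (ν + n + 1)

theorem besH_zero (ν x : ℝ) : besH ν 0 x = 1 := by simp [besH]

theorem besH_one (ν x : ℝ) : besH ν 1 x = ν * x := by simp [besH]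

theorem besH_rec (ν x : ℝ) (n : ℕ) :
    besH ν (n + 2) x = 2 * (ν + n + 1) * x * besH ν (n + 1) x - besH ν n x := by
  rw [besH]

theorem besH_neg (ν x : ℝ) (n : ℕ) : besH ν n (-x) = (-1) ^ n * besH ν n x := by
  induction n using Nat.twoStepInduction with
  | zero => simp [besH_zero]
  | one => simp [besH_one]
  | more n h0 h1 =>
    rw [besH_rec, besH_rec, h0, h1]
    ring

theorem besW_pos {ν : ℝ} (hν : 0 < ν) (n : ℕ) : 0 < besW ν n := by
  cases n with
  | zero => exact hν
  | succ n =>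
    simp only [besW]
    positivity

theorem besJ_eq_besH {ν : ℝ} (hν : 0 < ν) {z : ℝ} (hz : 0 < z)
    (hd : deriv (besselJ ν) z = 0) (n : ℕ) :
    besselJ (ν + n) z = besH ν n (1 / z) * besselJ ν z := by
  induction n using Nat.twoStepInduction with
  | zero => simp [besH_zero]
  | one =>
    rw [besselJ_deriv hν hz] at hd
    rw [besH_one]
    push_cast
    have : ν * (1 / z) = ν / z := by ring
    rw [this]
    linarith
  | more n h0 h1 =>
    have hr := besselJ_rec (by positivity : 0 < ν + n) hz
    have e1 : ν + (n + 1 : ℕ) = ν + n + 1 := by push_cast; ring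
    have e2 : ν + (n + 2 : ℕ) = ν + n + 2 := by push_cast; ring
    rw [e1] at h1
    rw [e2, besH_rec, sub_mul, ← h0]
    have : 2 * (ν + n + 1) * (1 / z) * besH ν (n + 1) (1 / z) * besselJ ν z =
        2 * (ν + n + 1) / z * (besH ν (n + 1) (1 / z) * besselJ ν z) := by ring
    rw [this, ← h1]
    linarith

theorem besJ_ne_zero {ν : ℝ} (hν : 0 < ν) {z : ℝ} (hz : 0 < z)
    (hd : deriv (besselJ ν) z = 0) : besselJ ν z ≠ 0 := by
  intro h0
  obtain ⟨n, hn⟩ := besselJ_exists_ne hν hz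
  apply hn
  rw [besJ_eq_besH hν hz hd, h0, mul_zero]

theorem besH_tendsto {ν : ℝ} (hν : 0 < ν) {z : ℝ} (hz : 0 < z)
    (hd : deriv (besselJ ν) z = 0) : Tendsto (fun n => besH ν n (1 / z)) atTop (𝓝 0) := by
  have h := (besselJ_tendsto hν hz).div_const (besselJ ν z)
  rw [zero_div] at h
  refine h.congr fun n => ?_
  rw [besJ_eq_besH hν hz hd, mul_div_assoc, div_self (besJ_ne_zero hν hz hd), mul_one]

theorem besH_partial (ν : ℝ) {z : ℝ} (hz : 0 < z) (N : ℕ) :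
    ∑ n ∈ range (N + 2), besW ν n * (besH ν n (1 / z)) ^ 2 =
      (z ^ 2 - ν ^ 2) - z ^ 2 / 2 *
        ((besH ν (N + 1) (1 / z)) ^ 2 - besH ν N (1 / z) * besH ν (N + 2) (1 / z) +
        ((besH ν (N + 2) (1 / z)) ^ 2 - besH ν (N + 1) (1 / z) * besH ν (N + 3) (1 / z))) := by
  induction N with
  | zero =>
    rw [sum_range_succ, sum_range_succ, sum_range_zero]
    simp only [besH, besW]
    push_cast
    field_simp
    ring
  | succ N ih =>
    rw [sum_range_succ, ih]
    have r2 := besH_rec ν (1 / z) N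
    have r3 := besH_rec ν (1 / z) (N + 1)
    have r4 := besH_rec ν (1 / z) (N + 2)
    rw [show N + 1 + 3 = N + 2 + 2 from rfl, show N + 1 + 2 = N + 3 from rfl,
      show N + 1 + 1 = N + 2 from rfl]
    rw [show N + 1 + 2 = N + 3 from rfl, show N + 1 + 1 = N + 2 from rfl] at r3
    rw [show N + 2 + 1 = N + 3 from rfl] at r4
    rw [r4, r3, r2]
    simp only [besW]
    push_cast
    generalize besH ν N (1 / z) = a
    generalize besH ν (N + 1) (1 / z) = b
    field_simp
    ring

theorem besH_hasSum {ν : ℝ} (hν : 0 < ν) {z : ℝ} (hz : 0 < z)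
    (hd : deriv (besselJ ν) z = 0) :
    HasSum (fun n => besW ν n * (besH ν n (1 / z)) ^ 2) (z ^ 2 - ν ^ 2) := by
  rw [hasSum_iff_tendsto_nat_of_nonneg
    (fun n => mul_nonneg (besW_pos hν n).le (sq_nonneg _)), ← tendsto_add_atTop_iff_nat 2]
  simp only [besH_partial ν hz]
  have h := besH_tendsto hν hz hd
  have h1 := (tendsto_add_atTop_iff_nat 1).mpr h
  have h2 := (tendsto_add_atTop_iff_nat 2).mpr h
  have h3 := (tendsto_add_atTop_iff_nat 3).mpr h
  have := (((((h1.pow 2).sub (h.mul h2)).add ((h2.pow 2).sub (h1.mul h3))).const_mul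
    (z ^ 2 / 2)).const_sub (z ^ 2 - ν ^ 2))
  simpa using this

theorem besH_converse {ν : ℝ} (hν : 0 < ν) {z c : ℝ} (hz : 0 < z) (hc : c ≠ 0)
    (ht : Tendsto (fun n => besH ν n (1 / z) * c) atTop (𝓝 0)) :
    deriv (besselJ ν) z = 0 := by
  have hJ := besselJ_tendsto hν hz
  have hW : ∀ n : ℕ, besH ν n (1 / z) * c * besselJ (ν + (n + 1 : ℕ)) z -
      besH ν (n + 1) (1 / z) * c * besselJ (ν + n) z =
      c * (besselJ (ν + 1) z - ν / z * besselJ ν z) := by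
    intro n
    induction n with
    | zero =>
      simp only [besH_zero, zero_add, besH_one]
      push_cast
      rw [add_zero]
      ring
    | succ n ih =>
      rw [← ih]
      have hr := besselJ_rec (by positivity : 0 < ν + n) hz
      have e1 : ν + (n + 1 : ℕ) = ν + n + 1 := by push_cast; ring
      have e2 : ν + (n + 1 + 1 : ℕ) = ν + n + 2 := by push_cast; ring
      rw [e2, e1, show n + 1 + 1 = n + 2 from rfl, besH_rec]
      have : besselJ (ν + n + 2) z = 2 * (ν + n + 1) / z * besselJ (ν + n + 1) z
        - besselJ (ν + n) z := by linarith
      rw [this]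
      ring
  have h1 := (ht.mul ((tendsto_add_atTop_iff_nat 1).mpr hJ)).sub
    (((tendsto_add_atTop_iff_nat 1).mpr ht).mul hJ)
  simp only [hW, mul_zero, sub_zero] at h1
  have h2 := tendsto_nhds_unique h1 tendsto_const_nhds
  have h3 := (mul_eq_zero.mp h2.symm).resolve_left hc
  rw [besselJ_deriv hν hz]
  linarith

theorem besH_even_zero (ν : ℝ) (n : ℕ) : besH ν (2 * n) 0 = (-1) ^ n := by
  induction n with
  | zero => simp [besH_zero]
  | succ n ih =>
    rw [show 2 * (n + 1) = 2 * n + 2 by ring, besH_rec, ih]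
    ring

theorem besH_zero_arg (ν c : ℝ)
    (ht : Tendsto (fun n => besH ν n 0 * c) atTop (𝓝 0)) : c = 0 := by
  have h1 : Tendsto (fun n : ℕ => 2 * n) atTop atTop :=
    tendsto_id.const_mul_atTop' (by norm_num)
  have h2 := (ht.comp h1).norm
  simp only [Function.comp_def, besH_even_zero, norm_mul, norm_pow, norm_neg, norm_one, one_pow,
    one_mul, norm_zero] at h2
  exact norm_eq_zero.mp (tendsto_nhds_unique tendsto_const_nhds h2)

theorem besW_tendsto {ν : ℝ} :
    Tendsto (fun n => 1 / Real.sqrt (besW ν n)) atTop (𝓝 0) := by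
  have h1 : Tendsto (besW ν) atTop atTop := by
    rw [← tendsto_add_atTop_iff_nat 1]
    have h3 : ∀ n : ℕ, (n : ℝ) + (ν + 1 + (ν + 1 + n)) = besW ν (n + 1) := by
      intro n; simp only [besW]; ring
    have : Tendsto (fun n : ℕ => 2 * ((n : ℝ) + (ν + 1))) atTop atTop :=
      (tendsto_atTop_add_const_right _ _ tendsto_natCast_atTop_atTop).const_mul_atTop
        (by norm_num)
    refine this.congr fun n => ?_
    simp only [besW]; ring
  have h2 := (Real.tendsto_sqrt_atTop.comp h1).inv_tendsto_atTop
  refine h2.congr fun n => ?_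
  simp

section zeros

variable {ν : ℝ} {jz : ℤ → ℝ}

theorem jz_pos (hν : 0 < ν) (h : IsBesselDerivZeros ν jz) {k : ℤ} (hk : 1 ≤ k) : 0 < jz k :=
  hν.trans (h.gt_nu k hk)

theorem jz_cases (hν : 0 < ν) (h : IsBesselDerivZeros ν jz) {k : ℤ} (hk : k ≠ 0) :
    (1 ≤ k ∧ 0 < jz k) ∨ (1 ≤ -k ∧ 0 < jz (-k) ∧ jz k = -jz (-k)) := by
  rcases lt_or_gt_of_ne hk with h1 | h1
  · right
    refine ⟨by omega, jz_pos hν h (by omega), ?_⟩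
    rw [h.odd_sym]; ring
  · left
    exact ⟨by omega, jz_pos hν h (by omega)⟩

theorem jz_ne (hν : 0 < ν) (h : IsBesselDerivZeros ν jz) {k : ℤ} (hk : k ≠ 0) : jz k ≠ 0 := by
  rcases jz_cases hν h hk with ⟨_, h2⟩ | ⟨_, h2, h3⟩
  · exact h2.ne'
  · rw [h3]; exact neg_ne_zero.mpr h2.ne'

theorem jz_sq_gt (hν : 0 < ν) (h : IsBesselDerivZeros ν jz) {k : ℤ} (hk : k ≠ 0) :
    0 < (jz k) ^ 2 - ν ^ 2 := by
  rcases jz_cases hν h hk with ⟨h1, h2⟩ | ⟨h1, h2, h3⟩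
  · nlinarith [h.gt_nu k h1]
  · rw [h3]; nlinarith [h.gt_nu _ h1]

theorem jz_inj_pos (h : IsBesselDerivZeros ν jz) {k l : ℤ} (hk : 1 ≤ k) (hl : 1 ≤ l)
    (he : jz k = jz l) : k = l := by
  rcases lt_trichotomy k l with h1 | h1 | h1
  · exact absurd he (h.mono k l hk h1).ne
  · exact h1
  · exact absurd he (h.mono l k hl h1).ne'

theorem jz_inj (hν : 0 < ν) (h : IsBesselDerivZeros ν jz) {k l : ℤ} (hk : k ≠ 0) (hl : l ≠ 0)
    (he : jz k = jz l) : k = l := by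
  rcases jz_cases hν h hk with ⟨h1, h2⟩ | ⟨h1, h2, h3⟩ <;>
  rcases jz_cases hν h hl with ⟨g1, g2⟩ | ⟨g1, g2, g3⟩
  · exact jz_inj_pos h h1 g1 he
  · linarith
  · linarith
  · have := jz_inj_pos h h1 g1 (by linarith)
    omega

theorem jz_hasSum (hν : 0 < ν) (h : IsBesselDerivZeros ν jz) {k : ℤ} (hk : k ≠ 0) :
    HasSum (fun n => besW ν n * (besH ν n (1 / jz k)) ^ 2) ((jz k) ^ 2 - ν ^ 2) := by
  rcases jz_cases hν h hk with ⟨h1, h2⟩ | ⟨h1, h2, h3⟩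
  · exact besH_hasSum hν h2 (h.is_zero k h1)
  · have := besH_hasSum hν h2 (h.is_zero _ h1)
    rw [h3, neg_sq]
    convert this using 2 with n
    rw [one_div_neg_eq_neg_one_div, besH_neg, mul_pow, ← pow_mul, mul_comm n 2, pow_mul]
    simp

theorem jz_converse (hν : 0 < ν) (h : IsBesselDerivZeros ν jz) {t c : ℝ} (hc : c ≠ 0)
    (ht : Tendsto (fun n => besH ν n t * c) atTop (𝓝 0)) : ∃ k : ℤ, k ≠ 0 ∧ t = 1 / jz k := by
  rcases lt_trichotomy t 0 with h1 | h1 | h1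
  · have hz : 0 < 1 / (-t) := by
      have : 0 < -t := by linarith
      positivity
    have hd := besH_converse hν (c := c) hz hc (by
      rw [one_div_one_div]
      rw [tendsto_zero_iff_norm_tendsto_zero] at ht ⊢
      refine ht.congr fun n => ?_
      rw [besH_neg]
      simp)
    obtain ⟨k, hk, hk2⟩ := h.complete _ hz hd
    refine ⟨-k, by omega, ?_⟩
    rw [h.odd_sym, hk2]
    have := h1.ne
    field_simp
  · subst h1
    exact absurd (besH_zero_arg ν c ht) hc
  · have hz : 0 < 1 / t := by positivity
    have hd := besH_converse hν (c := c) hz hc (by rw [one_div_one_div]; exact ht)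
    obtain ⟨k, hk, hk2⟩ := h.complete _ hz hd
    refine ⟨k, by omega, ?_⟩
    rw [hk2, one_div_one_div]

theorem jz_quadrature (hν : 0 < ν) (h : IsBesselDerivZeros ν jz) (n : ℕ) :
    HasSum (fun k : {z : ℤ // z ≠ 0} => besH ν n (1 / jz k) / ((jz k) ^ 2 - ν ^ 2))
      (if n = 0 then 1 / ν else 0) := by
  let s : ℕ → ℝ := fun n => Real.sqrt (besW ν n)
  have hs : ∀ n, 0 < s n := fun n => Real.sqrt_pos.mpr (besW_pos hν n)
  have hss : ∀ n, s n * s n = besW ν n := fun n => Real.mul_self_sqrt (besW_pos hν n).le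
  obtain ⟨T, hTc, hTs, hT0, hT1⟩ := hseq_exists_jacobi (fun n => 1 / s n) besW_tendsto
  let V : {z : ℤ // z ≠ 0} → HSeq := fun k =>
    ⟨fun n => s n * besH ν n (1 / jz k), hseq_mem (by
      have := (jz_hasSum hν h k.2).summable
      refine this.congr fun n => ?_
      rw [← hss]; ring)⟩
  have hV : ∀ k n, V k n = s n * besH ν n (1 / jz k) := fun k n => rfl
  have hVn : ∀ k, ‖V k‖ ^ 2 = (jz k) ^ 2 - ν ^ 2 := by
    intro k
    refine (hseq_hasSum_sq (V k)).unique ?_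
    have := jz_hasSum hν h k.2
    convert this using 2 with n
    rw [hV, ← hss]; ring
  have hVpos : ∀ k, 0 < ‖V k‖ := by
    intro k
    have h1 := hVn k
    have h2 := jz_sq_gt hν h k.2
    rcases (norm_nonneg (V k)).eq_or_lt with h3 | h3
    · rw [← h3] at h1; norm_num at h1; linarith
    · exact h3
  have hVe : ∀ k, T (V k) = (1 / jz k) • V k := by
    intro k
    ext n
    rw [lp.coeFn_smul, Pi.smul_apply, smul_eq_mul]
    have hsn := hs
    cases n with
    | zero =>
      rw [hT0, hV, hV, besH_one, besH_zero]
      have h0 := (hs 0).ne'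
      have h1 := (hs 1).ne'
      have h2 : s 0 * s 0 = ν := hss 0
      field_simp
      rw [sq, h2]
    | succ n =>
      rw [hT1, hV, hV, hV, besH_rec]
      have h0 := (hs n).ne'
      have h1 := (hs (n + 1)).ne'
      have h3 := (hs (n + 2)).ne'
      have h2 : s (n + 1) * s (n + 1) = 2 * (ν + n + 1) := hss (n + 1)
      rw [← h2]
      have hj := jz_ne hν h k.2
      field_simp
      ring
  have hmem : ∀ k : {z : ℤ // z ≠ 0}, V k ∈ Module.End.eigenspace (T : HSeq →ₗ[ℝ] HSeq) (1 / jz k) := by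
    intro k
    rw [Module.End.mem_eigenspace_iff]
    exact hVe k
  let b : {z : ℤ // z ≠ 0} → HSeq := fun k => (‖V k‖)⁻¹ • V k
  have hb : Orthonormal ℝ b := by
    constructor
    · intro k
      rw [norm_smul, norm_inv, norm_norm, inv_mul_cancel₀ (hVpos k).ne']
    · intro k l hkl
      have hne : 1 / jz k ≠ 1 / jz l := by
        intro he
        apply hkl
        apply Subtype.ext
        apply jz_inj hν h k.2 l.2
        simpa using he
      have := hTs.orthogonalFamily_eigenspaces hne ⟨V k, hmem k⟩ ⟨V l, hmem l⟩
      have h2 : inner ℝ (V k) (V l) = 0 := this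
      show inner ℝ ((‖V k‖)⁻¹ • V k) ((‖V l‖)⁻¹ • V l) = 0
      rw [inner_smul_left, inner_smul_right, h2]
      simp
  have hsp : (Submodule.span ℝ (Set.range b))ᗮ = ⊥ := by
    rw [eq_bot_iff, ← ContinuousLinearMap.orthogonalComplement_iSup_eigenspaces_eq_bot hTc hTs]
    apply Submodule.orthogonal_le
    apply iSup_le
    intro t u hu
    rw [Module.End.mem_eigenspace_iff] at hu
    have hu' : T u = t • u := hu
    have hcoord : ∀ n, T u n = t * u n := by intro n; rw [hu']; simp
    set c := u 0 / s 0 with hc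
    have hall : ∀ n, u n = s n * (besH ν n t * c) := by
      intro n
      induction n using Nat.twoStepInduction with
      | zero =>
        rw [besH_zero, hc]
        have := (hs 0).ne'
        field_simp
      | one =>
        have e := hcoord 0
        rw [hT0] at e
        have h0 := (hs 0).ne'
        have h1 := (hs 1).ne'
        have h2 : s 0 * s 0 = ν := hss 0
        rw [besH_one, hc, ← h2]
        field_simp at e ⊢
        linarith
      | more n i0 i1 =>
        have e := hcoord (n + 1)
        rw [hT1, i0, i1] at e
        have h0 := (hs n).ne'
        have h1 := (hs (n + 1)).ne'
        have h3 := (hs (n + 2)).ne'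
        have h2 : s (n + 1) * s (n + 1) = 2 * (ν + n + 1) := hss (n + 1)
        rw [besH_rec, ← h2]
        have e2 : u (n + 2) = s (n + 2) * (s (n + 1) * (t * (s (n + 1) * (besH ν (n + 1) t * c)))
          - besH ν n t * c) := by
          rw [← e]
          field_simp
          ring
        rw [e2]
        ring
    have hten : Tendsto (fun n => besH ν n t * c) atTop (𝓝 0) := by
      have h1 : Tendsto (fun n => (u n) ^ 2) atTop (𝓝 0) :=
        (hseq_hasSum_sq u).summable.tendsto_atTop_zero
      have h2 : Tendsto (fun n => u n) atTop (𝓝 0) := by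
        have := h1.sqrt
        simp only [Real.sqrt_sq_eq_abs, Real.sqrt_zero] at this
        exact (tendsto_zero_iff_abs_tendsto_zero _).mpr this
      have h3 := (besW_tendsto (ν := ν)).mul h2
      rw [zero_mul] at h3
      refine h3.congr fun n => ?_
      rw [hall n]
      have := (hs n).ne'
      show 1 / s n * _ = _
      field_simp
    by_cases hc0 : c = 0
    · have : u = 0 := by
        ext n
        rw [hall, hc0]
        simp
      rw [this]
      exact Submodule.zero_mem _
    · obtain ⟨k, hk, hkt⟩ := jz_converse hν h hc0 hten
      have : u = (c * ‖V ⟨k, hk⟩‖) • b ⟨k, hk⟩ := by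
        show u = (c * ‖V ⟨k, hk⟩‖) • ((‖V ⟨k, hk⟩‖)⁻¹ • V ⟨k, hk⟩)
        rw [smul_smul, mul_assoc, mul_inv_cancel₀ (hVpos _).ne', mul_one]
        ext n
        rw [hall, lp.coeFn_smul, Pi.smul_apply, hV, smul_eq_mul, hkt]
        ring
      rw [this]
      exact Submodule.smul_mem _ _ (Submodule.subset_span ⟨_, rfl⟩)
  let B := HilbertBasis.mkOfOrthogonalEqBot hb hsp
  have hB : ∀ k, B k = b k := fun k => by
    rw [show ⇑B = b from HilbertBasis.coe_mkOfOrthogonalEqBot hb hsp]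
  have key := B.hasSum_inner_mul_inner (lp.single 2 0 (1 : ℝ) : HSeq) (lp.single 2 n (1 : ℝ) : HSeq)
  have h0 := (hs 0).ne'
  have hn := (hs n).ne'
  have key2 := key.mul_left (1 / (s 0 * s n))
  have hf : (fun k : {z : ℤ // z ≠ 0} => besH ν n (1 / jz k) / ((jz k) ^ 2 - ν ^ 2)) =
      fun k => 1 / (s 0 * s n) * (inner ℝ (lp.single 2 0 (1 : ℝ) : HSeq) (B k) *
        inner ℝ (B k) (lp.single 2 n (1 : ℝ) : HSeq)) := by
    funext k
    rw [hB]
    show _ = _ * (inner ℝ _ ((‖V k‖)⁻¹ • V k) * inner ℝ ((‖V k‖)⁻¹ • V k) _)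
    rw [inner_smul_left, inner_smul_right, lp.inner_single_left, lp.inner_single_right, hV, hV,
      ← hVn, besH_zero]
    have := (hVpos k).ne'
    simp
    field_simp
  have hv : (if n = 0 then 1 / ν else 0) = 1 / (s 0 * s n) *
      inner ℝ (lp.single 2 0 (1 : ℝ) : HSeq) (lp.single 2 n (1 : ℝ) : HSeq) := by
    rw [lp.inner_single_left]
    by_cases hn0 : n = 0
    · subst hn0
      have h2 : s 0 * s 0 = ν := hss 0
      rw [h2]
      simp
    · have : (0 : ℕ) ≠ n := fun e => hn0 e.symm
      rw [lp.single_apply_ne _ _ _ this]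
      simp [hn0]
  rw [hf, hv]
  exact key2

end zeros

theorem hasSum_of_eq {ι : Type*} {f g : ι → ℝ} {a : ℝ} (hg : HasSum g a) (h : ∀ i, f i = g i) :
    HasSum f a := by
  have : f = g := funext h
  rw [this]; exact hg

/-- `qpoly` as a polynomial. -/
noncomputable def qP (ν : ℝ) : ℕ → Polynomial ℝ
  | 0 => 1
  | 1 => Polynomial.C (1 / 2) * Polynomial.X
  | n + 2 => Polynomial.X * qP ν (n + 1) -
      Polynomial.C (1 / (4 * (ν + n) * (ν + n + 1))) * qP ν n

theorem qpoly_rec (ν x : ℝ) (n : ℕ) : qpoly ν (n + 2) x =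
    x * qpoly ν (n + 1) x - (1 / (4 * (ν + n) * (ν + n + 1))) * qpoly ν n x := by
  rw [qpoly]

theorem qP_eval (ν x : ℝ) (n : ℕ) : (qP ν n).eval x = qpoly ν n x := by
  induction n using Nat.twoStepInduction with
  | zero => simp [qP, qpoly]
  | one => simp [qP, qpoly]; ring
  | more n h0 h1 =>
    rw [qpoly_rec, qP, Polynomial.eval_sub, Polynomial.eval_mul, Polynomial.eval_mul,
      Polynomial.eval_X, Polynomial.eval_C, h0, h1]

theorem qP_natDegree (ν : ℝ) (n : ℕ) : (qP ν n).natDegree ≤ n := by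
  induction n using Nat.twoStepInduction with
  | zero => simp [qP]
  | one => rw [qP]; compute_degree
  | more n h0 h1 =>
    rw [qP]
    refine (Polynomial.natDegree_sub_le _ _).trans (max_le ?_ ?_)
    · refine Polynomial.natDegree_mul_le.trans ?_
      rw [Polynomial.natDegree_X]
      omega
    · refine (Polynomial.natDegree_C_mul_le _ _).trans ?_
      omega

theorem qP_coeff (ν : ℝ) (n : ℕ) : (qP ν (n + 1)).coeff (n + 1) = 1 / 2 := by
  induction n with
  | zero => simp [qP]
  | succ n ih =>
    rw [qP, Polynomial.coeff_sub, Polynomial.coeff_X_mul, ih, Polynomial.coeff_C_mul,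
      Polynomial.coeff_eq_zero_of_natDegree_lt]
    · simp
    · have := qP_natDegree ν n
      omega

theorem qpoly_neg (ν x : ℝ) (n : ℕ) : qpoly ν n (-x) = (-1) ^ n * qpoly ν n x := by
  induction n using Nat.twoStepInduction with
  | zero => simp [qpoly]
  | one => simp [qpoly]; ring
  | more n h0 h1 =>
    rw [qpoly_rec, qpoly_rec, h0, h1]
    ring

theorem besH_eq_qpoly {ν : ℝ} (hν : 0 < ν) (n : ℕ) :
    ∃ g : ℝ, 0 < g ∧ (∀ x, besH ν n x = g * qpoly ν n x) ∧
      ∀ x, besH ν (n + 1) x = 2 * (ν + n) * g * qpoly ν (n + 1) x := by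
  induction n with
  | zero =>
    refine ⟨1, one_pos, fun x => by simp [besH, qpoly], fun x => ?_⟩
    simp [besH, qpoly]
    ring
  | succ n ih =>
    obtain ⟨g, hg, h0, h1⟩ := ih
    have hp : 0 < ν + n := by positivity
    refine ⟨2 * (ν + n) * g, by positivity, h1, fun x => ?_⟩
    rw [show n + 1 + 1 = n + 2 from rfl, besH_rec, qpoly_rec, h0, h1]
    push_cast
    have hp1 : 0 < ν + n + 1 := by positivity
    field_simp
    ring

section zeros2

variable {ν : ℝ} {jz : ℤ → ℝ}

theorem quad_q (hν : 0 < ν) (h : IsBesselDerivZeros ν jz) (m : ℕ) : ∀ n : ℕ, m < n →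
    HasSum (fun k : {z : ℤ // z ≠ 0} =>
      qpoly ν n (1 / jz k) * (1 / jz k) ^ m / ((jz k) ^ 2 - ν ^ 2)) 0 := by
  induction m with
  | zero =>
    intro n hn
    obtain ⟨g, hg, h0, -⟩ := besH_eq_qpoly hν n
    have := (jz_quadrature hν h n).mul_left (1 / g)
    rw [if_neg hn.ne', mul_zero] at this
    refine hasSum_of_eq this (fun k => ?_)
    rw [h0]
    field_simp
  | succ m ih =>
    intro n hn
    obtain ⟨l, rfl⟩ : ∃ l, n = l + 1 := ⟨n - 1, by omega⟩
    have h1 := ih (l + 2) (by omega)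
    have h2 := (ih l (by omega)).mul_left (1 / (4 * (ν + l) * (ν + l + 1)))
    have h3 := h1.add h2
    rw [mul_zero, add_zero] at h3
    refine hasSum_of_eq h3 (fun k => ?_)
    rw [qpoly_rec]
    ring

theorem jz_summable_eval (hν : 0 < ν) (h : IsBesselDerivZeros ν jz) (f : Polynomial ℝ) :
    Summable (fun k : {z : ℤ // z ≠ 0} => f.eval (1 / jz k) / (jz k) ^ 2) := by
  obtain ⟨K, hK⟩ := (isCompact_Icc (a := -(1 / ν)) (b := 1 / ν)).exists_bound_of_continuousOn
    (f := fun x => f.eval x) f.continuous.continuousOn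
  have h1 := ((jz_quadrature hν h 0).summable).mul_left K
  refine Summable.of_norm_bounded h1 fun k => ?_
  have hp := jz_sq_gt hν h k.2
  have hj := jz_ne hν h k.2
  have habs : ν ≤ |jz k| := by
    rw [← abs_of_pos hν]
    exact sq_le_sq.mp (by linarith)
  have hmem : 1 / jz k ∈ Set.Icc (-(1 / ν)) (1 / ν) := by
    rw [Set.mem_Icc, ← abs_le, abs_div, abs_one]
    exact one_div_le_one_div_of_le hν habs
  have hb := hK _ hmem
  have hK0 : 0 ≤ K := (norm_nonneg _).trans hb
  rw [norm_div, besH_zero, norm_pow, Real.norm_eq_abs (jz k), sq_abs, div_eq_mul_one_div]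
  have hν2 : 0 < ν ^ 2 := by positivity
  exact mul_le_mul hb (one_div_le_one_div_of_le hp (by linarith)) (by positivity) hK0

theorem poly_eq_zero_of_orth (hν : 0 < ν) (h : IsBesselDerivZeros ν jz) (n : ℕ)
    (R : Polynomial ℝ) (hdeg : R.degree < n)
    (ho : ∀ m < n, HasSum (fun k : {z : ℤ // z ≠ 0} =>
      R.eval (1 / jz k) * (1 / jz k) ^ m / (jz k) ^ 2) 0) : R = 0 := by
  by_contra hR
  have hnd : R.natDegree < n := (Polynomial.natDegree_lt_iff_degree_lt hR).mpr hdeg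
  have h1 : HasSum (fun k : {z : ℤ // z ≠ 0} => ∑ i ∈ range n,
      R.coeff i * (R.eval (1 / jz k) * (1 / jz k) ^ i / (jz k) ^ 2))
      (∑ i ∈ range n, R.coeff i * 0) :=
    hasSum_sum fun i hi => (ho i (mem_range.mp hi)).mul_left _
  simp only [mul_zero, sum_const_zero] at h1
  have h2 : (fun k : {z : ℤ // z ≠ 0} => ∑ i ∈ range n,
      R.coeff i * (R.eval (1 / jz k) * (1 / jz k) ^ i / (jz k) ^ 2)) =
      fun k : {z : ℤ // z ≠ 0} => (R.eval (1 / jz k)) ^ 2 / (jz k) ^ 2 := by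
    funext k
    have e : R.eval (1 / jz k) = ∑ i ∈ range n, R.coeff i * (1 / jz k) ^ i :=
      Polynomial.eval_eq_sum_range' hnd _
    have e2 : (R.eval (1 / jz k)) ^ 2 / (jz k) ^ 2 =
        R.eval (1 / jz k) / (jz k) ^ 2 * ∑ i ∈ range n, R.coeff i * (1 / jz k) ^ i := by
      rw [← e]; ring
    rw [e2, mul_sum]
    exact sum_congr rfl fun i _ => by ring
  rw [h2] at h1
  have h3 := (hasSum_zero_iff_of_nonneg (fun k => by positivity)).mp h1
  have h4 : ∀ k : ℤ, k ≠ 0 → R.eval (1 / jz k) = 0 := by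
    intro k hk
    have := congrFun h3 ⟨k, hk⟩
    have hj := jz_ne hν h hk
    simpa [hj] using this
  apply hR
  apply Polynomial.eq_zero_of_infinite_isRoot
  have hinj : Function.Injective (fun k : ℕ => 1 / jz (k + 1)) := by
    intro a b hab
    have h5 : jz (a + 1) = jz (b + 1) := by simpa using hab
    have := jz_inj hν h (by omega) (by omega) h5
    omega
  refine (Set.infinite_range_of_injective hinj).mono ?_
  rintro _ ⟨k, rfl⟩
  exact h4 _ (by omega)

end zeros2

/-- Explicit formula for the monic orthogonal polynomials `p_{n,ν}` with respect to the
moment functional `L(f) = ∑_{k∈ℤ∖{0}} f(1/j'_{ν,k})/(j'_{ν,k})²`, whose moments are the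
Rayleigh-type sums `μ_n = σ'_ν(n+2)` over the zeros of `J_ν'`. -/
theorem monic_op_formula (ν : ℝ) (hν : 0 < ν) (jz : ℤ → ℝ)
    (hjz : IsBesselDerivZeros ν jz) (p : ℕ → Polynomial ℝ)
    (hmonic : ∀ n, (p n).Monic) (hdeg : ∀ n, (p n).natDegree = n)
    (horth : ∀ n m : ℕ, m < n →
      ∑' k : {z : ℤ // z ≠ 0}, (p n).eval (1 / jz k) * (1 / jz k) ^ m / (jz k) ^ 2 = 0)
    (n : ℕ) (x : ℝ) :
    (p n).eval x * (x ^ 2 - (1 / ν) ^ 2) * qpoly ν n (1 / ν) / 2 =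
      qpoly ν n (1 / ν) * qpoly ν (n + 2) x - qpoly ν n x * qpoly ν (n + 2) (1 / ν) := by
  set c := qpoly ν n (1 / ν) with hc
  set d := qpoly ν (n + 2) (1 / ν) with hd
  let G : Polynomial ℝ := Polynomial.C c * qP ν (n + 2) - Polynomial.C d * qP ν n
  have hG : ∀ y, G.eval y = c * qpoly ν (n + 2) y - qpoly ν n y * d := by
    intro y
    simp only [G, Polynomial.eval_sub, Polynomial.eval_mul, Polynomial.eval_C, qP_eval]
    ring
  let P : Polynomial ℝ := Polynomial.X ^ 2 - Polynomial.C ((1 / ν) ^ 2)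
  have hPm : P.Monic := Polynomial.monic_X_pow_sub_C _ (by norm_num)
  have hPd : P.natDegree = 2 := Polynomial.natDegree_X_pow_sub_C
  have hPe : ∀ y, P.eval y = y ^ 2 - (1 / ν) ^ 2 := by
    intro y
    simp [P]
  have hG1 : G.eval (1 / ν) = 0 := by rw [hG]; ring
  have hG2 : G.eval (-(1 / ν)) = 0 := by
    rw [hG, qpoly_neg, qpoly_neg, ← hc, ← hd]
    ring
  have hdvd : P ∣ G := by
    have hfac : P = (Polynomial.X - Polynomial.C (1 / ν)) *
        (Polynomial.X - Polynomial.C (-(1 / ν))) := by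
      simp only [P, map_neg, map_pow]
      ring
    rw [hfac]
    refine IsCoprime.mul_dvd ?_ (Polynomial.dvd_iff_isRoot.mpr hG1)
      (Polynomial.dvd_iff_isRoot.mpr hG2)
    apply Polynomial.isCoprime_X_sub_C_of_isUnit_sub
    rw [isUnit_iff_ne_zero]
    have : 0 < 1 / ν := by positivity
    have h2 : 0 < 1 / ν - -(1 / ν) := by linarith
    exact h2.ne'
  obtain ⟨Q, hQ⟩ := hdvd
  have hR : Polynomial.C (c / 2) * p n - Q = 0 := by
    refine poly_eq_zero_of_orth hν hjz n _ ?_ ?_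
    · have hmul : (P * (Polynomial.C (c / 2) * p n - Q)).degree < ((n + 2 : ℕ) : WithBot ℕ) := by
        rw [mul_sub, ← hQ]
        rw [Polynomial.degree_lt_iff_coeff_zero]
        intro k hk
        have hPp : (P * p n).Monic := hPm.mul (hmonic n)
        have hPpd : (P * p n).natDegree = n + 2 := by
          rw [hPm.natDegree_mul (hmonic n), hPd, hdeg]; omega
        have e1 : P * (Polynomial.C (c / 2) * p n) = Polynomial.C (c / 2) * (P * p n) := by ring
        rw [e1]
        simp only [G, Polynomial.coeff_sub, Polynomial.coeff_C_mul]
        have hn0 : (qP ν n).coeff k = 0 := Polynomial.coeff_eq_zero_of_natDegree_lt (by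
          have := qP_natDegree ν n
          omega)
        rw [hn0]
        rcases hk.eq_or_lt with hk1 | hk1
        · subst hk1
          have e2 : (P * p n).coeff (n + 2) = 1 := by
            rw [← hPpd]; exact hPp
          rw [e2, qP_coeff ν (n + 1)]
          ring
        · have e2 : (P * p n).coeff k = 0 :=
            Polynomial.coeff_eq_zero_of_natDegree_lt (by omega)
          have e3 : (qP ν (n + 2)).coeff k = 0 := Polynomial.coeff_eq_zero_of_natDegree_lt (by
            have := qP_natDegree ν (n + 2)
            omega)
          rw [e2, e3]
          ring
      by_cases hR0 : Polynomial.C (c / 2) * p n - Q = 0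
      · rw [hR0, Polynomial.degree_zero]
        exact WithBot.bot_lt_coe n
      · have h1 : P * (Polynomial.C (c / 2) * p n - Q) ≠ 0 := mul_ne_zero hPm.ne_zero hR0
        rw [← Polynomial.natDegree_lt_iff_degree_lt h1, Polynomial.natDegree_mul hPm.ne_zero hR0,
          hPd] at hmul
        rw [← Polynomial.natDegree_lt_iff_degree_lt hR0]
        omega
    · intro m hm
      have h1 : HasSum (fun k : {z : ℤ // z ≠ 0} =>
          (p n).eval (1 / jz k) * (1 / jz k) ^ m / (jz k) ^ 2) 0 := by
        have hs := jz_summable_eval hν hjz (p n * Polynomial.X ^ m)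
        simp only [Polynomial.eval_mul, Polynomial.eval_pow, Polynomial.eval_X] at hs
        rw [← horth n m hm]
        exact hs.hasSum
      have h2 := (quad_q hν hjz m (n + 2) (by omega)).mul_left (-(ν ^ 2 * c))
      have h3 := (quad_q hν hjz m n hm).mul_left (ν ^ 2 * d)
      have h4 := (h1.mul_left (c / 2)).sub (h2.add h3)
      simp only [mul_zero, add_zero, sub_zero] at h4
      refine hasSum_of_eq h4 (fun k => ?_)
      have hj := jz_ne hν hjz k.2
      have hp := (jz_sq_gt hν hjz k.2).ne'
      have hq : G.eval (1 / jz k) = ((1 / jz k) ^ 2 - (1 / ν) ^ 2) * Q.eval (1 / jz k) := by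
        rw [hQ, Polynomial.eval_mul, hPe]
      rw [hG] at hq
      have hq2 : Q.eval (1 / jz k) / (jz k) ^ 2 = -(ν ^ 2 *
          (c * qpoly ν (n + 2) (1 / jz k) - qpoly ν n (1 / jz k) * d) /
            ((jz k) ^ 2 - ν ^ 2)) := by
        rw [hq]
        field_simp
        ring
      rw [Polynomial.eval_sub, Polynomial.eval_mul, Polynomial.eval_C, sub_mul, sub_div]
      have e5 : Q.eval (1 / jz k) * (1 / jz k) ^ m / (jz k) ^ 2 =
        Q.eval (1 / jz k) / (jz k) ^ 2 * (1 / jz k) ^ m := by ring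
      rw [e5, hq2]
      ring
  have hfin : Q.eval x = c / 2 * (p n).eval x := by
    rw [← sub_eq_zero.mp hR, Polynomial.eval_mul, Polynomial.eval_C]
  rw [← hG, hQ, Polynomial.eval_mul, hPe, hfin]
  ring
end

section
/- For ν a real number not equal to 0, −1, −2, …, and every n ≥ 1, the Hankel determinant Δ_n = det(σ'_ν(i+j+2))_{0≤i,j≤n} of the Rayleigh-type sums over the zeros of J'_ν satisfies Δ_n = ν²·q_{n+1,ν}(1/ν)·q_{n+2,ν}(1/ν) / (2^{n²−2}·(ν+1)^{2n−1}·(ν+2)^{2n−3}···(ν+n−1)³·(ν+n)). -/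
open Finset

/-- Taylor coefficients of the normalized Bessel derivative
`2^ν Γ(ν) x^{1-ν} J_ν'(x) = ∑_k c_{2k} x^{2k}`: `c_{2k+1} = 0` and
`c_{2k} = (-1)^k (ν/2+1)_k / (k! 4^k (ν/2)_k (ν+1)_k)`. -/
noncomputable def besselDerivCoeff (ν : ℝ) (m : ℕ) : ℝ :=
  if m % 2 = 1 then 0
  else (-1) ^ (m / 2) * (ascPochhammer ℝ (m / 2)).eval (ν / 2 + 1) /
    ((m / 2).factorial * 4 ^ (m / 2) * (ascPochhammer ℝ (m / 2)).eval (ν / 2) *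
      (ascPochhammer ℝ (m / 2)).eval (ν + 1))

/-- The Rayleigh-type sums `σ'_ν(n)` over the zeros of `J_ν'`, extended analytically in `ν`
via the determinant formula in the Taylor coefficients of the normalized Bessel derivative. -/
noncomputable def sigmaBessel (ν : ℝ) (n : ℕ) : ℝ :=
  (-1) ^ n * Matrix.det (Matrix.of fun i j : Fin n =>
    if (j : ℕ) = 0 then ((i : ℕ) + 1) * besselDerivCoeff ν ((i : ℕ) + 1)
    else if (j : ℕ) ≤ (i : ℕ) + 1 then besselDerivCoeff ν ((i : ℕ) + 1 - (j : ℕ)) else 0)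

/-- The Hankel determinant `Δ_n` with `(i,j)` entry `σ'_ν(i+j+2)`, `0 ≤ i,j ≤ n`. -/
noncomputable def hankelDelta (ν : ℝ) (n : ℕ) : ℝ :=
  Matrix.det (Matrix.of fun i j : Fin (n + 1) => sigmaBessel ν ((i : ℕ) + (j : ℕ) + 2))

/-- Coefficients of the normalized Bessel function of order `μ`. -/
noncomputable def bco (μ : ℝ) : ℕ → ℝ
  | 0 => 1
  | 1 => 0
  | m + 2 => -bco μ m / ((m + 2) * (m + 2 + 2 * μ))

lemma bco_odd (μ : ℝ) (k : ℕ) : bco μ (2 * k + 1) = 0 := by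
  induction k with
  | zero => simp [bco]
  | succ k ih =>
    have : 2 * (k + 1) + 1 = (2 * k + 1) + 2 := by ring
    rw [this, bco, ih]; simp

lemma poch_ne (x : ℝ) (hx : ∀ k : ℕ, x + k ≠ 0) (k : ℕ) : (ascPochhammer ℝ k).eval x ≠ 0 := by
  induction k with
  | zero => simp
  | succ k ih => rw [ascPochhammer_succ_eval]; exact mul_ne_zero ih (hx k)

lemma bco_even (μ : ℝ) (k : ℕ) : bco μ (2 * k) =
    (-1) ^ k / (k.factorial * 4 ^ k * (ascPochhammer ℝ k).eval (μ + 1)) := by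
  induction k with
  | zero => simp [bco]
  | succ k ih =>
    have : 2 * (k + 1) = (2 * k) + 2 := by ring
    rw [this, bco, ih, ascPochhammer_succ_eval, Nat.factorial_succ, pow_succ, pow_succ, neg_div,
      div_div, ← neg_div]
    congr 1
    · ring
    · push_cast; ring

lemma poch_ratio (x : ℝ) (k : ℕ) :
    (ascPochhammer ℝ k).eval (x + 1) * x = (ascPochhammer ℝ k).eval x * (x + k) := by
  induction k with
  | zero => simp
  | succ k ih =>
    rw [ascPochhammer_succ_eval, ascPochhammer_succ_eval]
    push_cast
    linear_combination (x + 1 + k) * ih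

lemma nu_add_ne {ν : ℝ} (hν : ∀ k : ℕ, ν ≠ -(k : ℝ)) (k : ℕ) : ν + k ≠ 0 := by
  intro h; exact hν k (by linarith)

lemma coeff_eq {ν : ℝ} (hν : ∀ k : ℕ, ν ≠ -(k : ℝ)) (m : ℕ) :
    besselDerivCoeff ν m = bco ν m * (ν + m) / ν := by
  have h0 : ν ≠ 0 := by simpa using hν 0
  rcases Nat.even_or_odd' m with ⟨k, rfl | rfl⟩
  · have e1 : 2 * k % 2 = 0 := by omega
    have e2 : 2 * k / 2 = k := by omega
    rw [besselDerivCoeff, e1, e2, bco_even, if_neg (by norm_num)]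
    have p1 := poch_ratio (ν / 2) k
    have p2 : (ascPochhammer ℝ k).eval (ν / 2) ≠ 0 := by
      apply poch_ne
      intro j h
      apply nu_add_ne hν (2 * j)
      push_cast; linarith
    have p3 : (ascPochhammer ℝ k).eval (ν + 1) ≠ 0 := by
      apply poch_ne
      intro j h
      apply nu_add_ne hν (j + 1)
      push_cast; linarith
    have p4 : (k.factorial : ℝ) ≠ 0 := by positivity
    generalize (ascPochhammer ℝ k).eval (ν / 2 + 1) = A at *
    generalize (ascPochhammer ℝ k).eval (ν / 2) = B at *
    generalize (ascPochhammer ℝ k).eval (ν + 1) = D at *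
    have : A = B * (ν + 2 * k) / ν := by
      field_simp; linear_combination 2 * p1
    rw [this]
    push_cast
    field_simp
  · have e1 : (2 * k + 1) % 2 = 1 := by omega
    rw [besselDerivCoeff, if_pos e1, bco_odd]; simp

lemma bco_step {μ : ℝ} (hμ : ∀ k : ℕ, μ + 1 + k ≠ 0) (m : ℕ) :
    ((m : ℝ) + 2) * (m + 2 + 2 * μ) * bco μ (m + 2) = - bco μ m := by
  rcases Nat.even_or_odd' m with ⟨k, rfl | rfl⟩
  · have h1 : ((2 * k : ℕ) : ℝ) + 2 + 2 * μ ≠ 0 := by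
      intro h; apply hμ k; push_cast at h; linarith
    have h2 : ((2 * k : ℕ) : ℝ) + 2 ≠ 0 := by positivity
    rw [bco]; field_simp
  · have : 2 * k + 1 + 2 = 2 * (k + 1) + 1 := by ring
    rw [this, bco_odd, bco_odd]; simp

lemma bco_contig {μ : ℝ} (hμ : ∀ k : ℕ, μ + 1 + k ≠ 0) (m : ℕ) :
    bco (μ + 1) m * (2 * μ + 2 + m) = 2 * (μ + 1) * bco μ m := by
  rcases Nat.even_or_odd' m with ⟨k, rfl | rfl⟩
  · rw [bco_even, bco_even]
    have p1 := poch_ratio (μ + 1) k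
    have p2 := poch_ne (μ + 1) hμ k
    have p3 : (ascPochhammer ℝ k).eval (μ + 1 + 1) ≠ 0 := by
      apply poch_ne
      intro j h
      apply hμ (j + 1)
      push_cast; linarith
    have p4 : (k.factorial : ℝ) ≠ 0 := by positivity
    generalize (ascPochhammer ℝ k).eval (μ + 1 + 1) = A at *
    generalize (ascPochhammer ℝ k).eval (μ + 1) = B at *
    push_cast
    field_simp
    linear_combination -p1
  · rw [bco_odd, bco_odd]; simp

lemma bco_comb {μ : ℝ} (hμ : ∀ k : ℕ, μ + 1 + k ≠ 0) (m : ℕ) :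
    bco (μ + 1) m = -2 * (μ + 1) * (m + 2) * bco μ (m + 2) := by
  have b := bco_step hμ m
  have c := bco_contig hμ m
  rcases Nat.even_or_odd' m with ⟨k, rfl | rfl⟩
  · have h3 : 2 * μ + 2 + ((2 * k : ℕ) : ℝ) ≠ 0 := by
      intro h; apply hμ k; push_cast at h; linarith
    apply mul_right_cancel₀ h3
    linear_combination c + 2 * (μ + 1) * b
  · have : 2 * k + 1 + 2 = 2 * (k + 1) + 1 := by ring
    rw [this, bco_odd, bco_odd]; simp

/-- three-term relation -/
lemma bco_three {μ : ℝ} (hμ : ∀ k : ℕ, μ + k ≠ 0) (m : ℕ) (hμ' : μ ≠ 0) :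
    bco (μ - 1) (m + 2) = bco μ (m + 2) - 1 / (4 * μ * (μ + 1)) * bco (μ + 1) m := by
  have h1 : ∀ k : ℕ, μ + 1 + k ≠ 0 := fun k h => hμ (k + 1) (by push_cast; linarith)
  have h2 : ∀ k : ℕ, μ - 1 + 1 + k ≠ 0 := fun k h => hμ k (by linarith)
  have a := bco_contig h2 (m + 2)
  rw [sub_add_cancel] at a
  have h0 : μ + 1 ≠ 0 := by simpa using hμ 1
  push_cast at a
  rw [bco_comb h1]
  field_simp
  linear_combination -2 * a

open PowerSeries in
/-- The normalized Bessel derivative followed by the normalized Bessel functions. -/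
noncomputable def Phi (ν : ℝ) : ℕ → PowerSeries ℝ
  | 0 => PowerSeries.mk (besselDerivCoeff ν)
  | m + 1 => PowerSeries.mk (bco (ν + m))

noncomputable def lam (ν : ℝ) (m : ℕ) : ℝ := (if m = 0 then 2 else 1) / (4 * (ν + m) * (ν + m + 1))

lemma ext_two {f g : PowerSeries ℝ} (h0 : PowerSeries.coeff 0 f = PowerSeries.coeff 0 g)
    (h1 : PowerSeries.coeff 1 f = PowerSeries.coeff 1 g)
    (h : ∀ m, PowerSeries.coeff (m + 2) f = PowerSeries.coeff (m + 2) g) : f = g := by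
  ext n
  match n with
  | 0 => exact h0
  | 1 => exact h1
  | m + 2 => exact h m

lemma Phi_rec {ν : ℝ} (hν : ∀ k : ℕ, ν ≠ -(k : ℝ)) (m : ℕ) :
    Phi ν m = Phi ν (m + 1) - PowerSeries.X ^ 2 * (PowerSeries.C (lam ν m) * Phi ν (m + 2)) := by
  have hne := nu_add_ne hν
  have h0 : ν ≠ 0 := by simpa using hν 0
  apply ext_two
  · cases m <;> simp [Phi, coeff_eq hν, bco, h0, pow_two, mul_assoc]
  · rw [map_sub, PowerSeries.coeff_X_pow_mul']
    cases m <;> simp [Phi, coeff_eq hν, bco]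
  · intro j
    rw [map_sub, PowerSeries.coeff_X_pow_mul, PowerSeries.coeff_C_mul]
    cases m with
    | zero =>
      simp only [Phi, PowerSeries.coeff_mk, coeff_eq hν, lam]
      have h1 : ∀ k : ℕ, ν + 1 + k ≠ 0 := fun k h => hne (k + 1) (by push_cast; linarith)
      have h01 : ν + 1 ≠ 0 := by simpa using hne 1
      simp only [Nat.cast_zero, add_zero, Nat.cast_one, if_true]
      rw [bco_comb h1]
      push_cast
      field_simp
      ring
    | succ m =>
      simp only [Phi, PowerSeries.coeff_mk, lam]
      have h1 : ∀ k : ℕ, (ν + (m + 1 : ℕ)) + k ≠ 0 := fun k h => hne (m + 1 + k) (by push_cast at *; linarith)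
      have := bco_three h1 j (hne _)
      rw [show ν + (m + 1 : ℕ) - 1 = ν + m by push_cast; ring,
        show ν + (m + 1 : ℕ) + 1 = ν + (m + 1 + 1 : ℕ) by push_cast; ring] at this
      rw [this]
      rw [if_neg (by omega), show ν + (m + 1 : ℕ) + 1 = ν + (m + 1 + 1 : ℕ) by push_cast; ring]

lemma Phi_ode {ν : ℝ} (hν : ∀ k : ℕ, ν ≠ -(k : ℝ)) :
    PowerSeries.X * PowerSeries.derivative ℝ (Phi ν 0) + PowerSeries.C ν * Phi ν 0 =
      PowerSeries.C ν * Phi ν 1 - PowerSeries.X ^ 2 * (PowerSeries.C (1 / ν) * Phi ν 1) := by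
  have hne := nu_add_ne hν
  have h0 : ν ≠ 0 := by simpa using hν 0
  have h1 : ∀ k : ℕ, ν + 1 + k ≠ 0 := fun k h => hne (k + 1) (by push_cast; linarith)
  apply ext_two
  · simp [Phi, coeff_eq hν, bco, h0, pow_two, mul_assoc]
  · rw [map_sub, PowerSeries.coeff_X_pow_mul', map_add, PowerSeries.coeff_succ_X_mul]
    simp [Phi, coeff_eq hν, bco, PowerSeries.coeff_derivative]
  · intro j
    rw [map_sub, map_add, PowerSeries.coeff_X_pow_mul, PowerSeries.coeff_succ_X_mul]
    simp only [Phi, PowerSeries.coeff_derivative, PowerSeries.coeff_mk, PowerSeries.coeff_C_mul, coeff_eq hν]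
    have b := bco_step h1 j
    push_cast
    simp only [add_zero]
    field_simp
    linear_combination b

/-- The generating function of the Rayleigh sums. -/
noncomputable def tau (ν : ℝ) : PowerSeries ℝ :=
  -(PowerSeries.X * PowerSeries.derivative ℝ (Phi ν 0)) * (Phi ν 0)⁻¹

lemma Phi0_zero {ν : ℝ} (hν : ∀ k : ℕ, ν ≠ -(k : ℝ)) : besselDerivCoeff ν 0 = 1 := by
  have h0 : ν ≠ 0 := by simpa using hν 0
  simp [coeff_eq hν, bco, h0]

lemma Phi0_const {ν : ℝ} (hν : ∀ k : ℕ, ν ≠ -(k : ℝ)) :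
    PowerSeries.constantCoeff (Phi ν 0) = 1 := by
  rw [← PowerSeries.coeff_zero_eq_constantCoeff_apply, Phi, PowerSeries.coeff_mk, Phi0_zero hν]

lemma Phi0_inv {ν : ℝ} (hν : ∀ k : ℕ, ν ≠ -(k : ℝ)) : (Phi ν 0)⁻¹ * Phi ν 0 = 1 :=
  PowerSeries.inv_mul_cancel _ (by rw [Phi0_const hν]; exact one_ne_zero)

lemma tau_mul {ν : ℝ} (hν : ∀ k : ℕ, ν ≠ -(k : ℝ)) :
    tau ν * Phi ν 0 = -(PowerSeries.X * PowerSeries.derivative ℝ (Phi ν 0)) := by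
  rw [tau, mul_assoc, Phi0_inv hν, mul_one]

lemma tau_newton {ν : ℝ} (hν : ∀ k : ℕ, ν ≠ -(k : ℝ)) (i : ℕ) :
    ((i : ℝ) + 1) * besselDerivCoeff ν (i + 1) =
      - ∑ k ∈ Finset.range (i + 1), PowerSeries.coeff (k + 1) (tau ν) * besselDerivCoeff ν (i - k) := by
  have h := congrArg (PowerSeries.coeff (i + 1)) (tau_mul hν)
  have hz : PowerSeries.coeff 0 (tau ν) = 0 := by
    simp [tau]
  rw [PowerSeries.coeff_mul, Finset.Nat.sum_antidiagonal_eq_sum_range_succ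
    (fun a b => PowerSeries.coeff a (tau ν) * PowerSeries.coeff b (Phi ν 0)),
    Finset.sum_range_succ', hz, zero_mul, add_zero, map_neg, PowerSeries.coeff_succ_X_mul,
    PowerSeries.coeff_derivative] at h
  simp only [Phi, PowerSeries.coeff_mk, Nat.add_sub_add_right] at h
  rw [h]; ring

lemma sigma_eq {ν : ℝ} (hν : ∀ k : ℕ, ν ≠ -(k : ℝ)) (n : ℕ) :
    sigmaBessel ν (n + 1) = PowerSeries.coeff (n + 1) (tau ν) := by
  rw [sigmaBessel]
  set T : Matrix (Fin (n + 1)) (Fin (n + 1)) ℝ := Matrix.of fun i j =>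
    if (j : ℕ) ≤ i then besselDerivCoeff ν (i - j) else 0 with hT
  set N : Matrix (Fin (n + 1)) (Fin (n + 1)) ℝ := Matrix.of fun i j =>
    if (j : ℕ) = 0 then - PowerSeries.coeff ((i : ℕ) + 1) (tau ν)
    else if (i : ℕ) + 1 = j then 1 else 0 with hN
  have hTd : T.det = 1 := by
    rw [Matrix.det_of_isLowerTriangular]
    · simp [hT, Phi0_zero hν]
    · intro i j hij
      have : (i : ℕ) < j := by simpa using hij
      simp only [hT, Matrix.of_apply]
      rw [if_neg (by omega)]
  have hNd : N.det = (-1) ^ n * - PowerSeries.coeff (n + 1) (tau ν) := by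
    rw [Matrix.det_succ_row N (Fin.last n), Fin.sum_univ_succ, Finset.sum_eq_zero]
    · have : N.submatrix (Fin.last n).succAbove (Fin.succAbove 0) = 1 := by
        ext i j
        simp only [hN, Matrix.submatrix_apply, Matrix.of_apply, Fin.succAbove_last,
          Fin.succAbove_zero, Fin.val_castSucc, Fin.val_succ, Matrix.one_apply]
        rw [if_neg (by omega)]
        by_cases h : i = j
        · rw [if_pos h, if_pos (by rw [h])]
        · rw [if_neg h, if_neg (fun h' => h (Fin.ext (by omega)))]
      rw [this]
      simp [hN]
    · intro j _
      have : N (Fin.last n) j.succ = 0 := by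
        have hj := j.isLt
        simp only [hN, Matrix.of_apply, Fin.val_last, Fin.val_succ]
        rw [if_neg (by omega), if_neg (by omega)]
      rw [this]; simp
  have hM : (Matrix.of fun i j : Fin (n + 1) =>
    if (j : ℕ) = 0 then ((i : ℕ) + 1) * besselDerivCoeff ν ((i : ℕ) + 1)
    else if (j : ℕ) ≤ (i : ℕ) + 1 then besselDerivCoeff ν ((i : ℕ) + 1 - (j : ℕ)) else 0) = T * N := by
    ext i j
    rw [Matrix.mul_apply]
    simp only [hT, hN, Matrix.of_apply]
    by_cases hj : (j : ℕ) = 0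
    · simp only [hj, if_true]
      rw [tau_newton hν, Fin.sum_univ_eq_sum_range (fun k =>
        (if k ≤ (i : ℕ) then besselDerivCoeff ν ((i : ℕ) - k) else 0) *
          -PowerSeries.coeff (k + 1) (tau ν)) (n + 1), ← Finset.sum_neg_distrib]
      rw [← Finset.sum_subset (Finset.range_subset_range.2 (show (i : ℕ) + 1 ≤ n + 1 by omega))]
      · apply Finset.sum_congr rfl
        intro k hk
        rw [Finset.mem_range] at hk
        rw [if_pos (by omega)]; ring
      · intro k _ hk
        rw [Finset.mem_range] at hk
        rw [if_neg (by omega)]; ring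
    · simp only [hj, if_false]
      rw [Finset.sum_eq_single (⟨(j : ℕ) - 1, by omega⟩ : Fin (n + 1))]
      · simp only
        rw [if_pos (show (j : ℕ) - 1 + 1 = j by omega), mul_one]
        by_cases h : (j : ℕ) ≤ i + 1
        · rw [if_pos h, if_pos (by omega)]
          congr 1; omega
        · rw [if_neg h, if_neg (by omega)]
      · intro k _ hk
        rw [if_neg (c := (k : ℕ) + 1 = j), mul_zero]
        intro h
        apply hk
        ext; simp; omega
      · simp
  rw [hM, Matrix.det_mul, hTd, hNd, pow_succ]
  have : ((-1 : ℝ) ^ n) * (-1) ^ n = 1 := by rw [← mul_pow]; simp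
  linear_combination PowerSeries.coeff (n + 1) (tau ν) * this

noncomputable def Sser (ν : ℝ) : PowerSeries ℝ := PowerSeries.C (1 / ν) * Phi ν 1 * (Phi ν 0)⁻¹

lemma Sser_mul {ν : ℝ} (hν : ∀ k : ℕ, ν ≠ -(k : ℝ)) :
    Sser ν * Phi ν 0 = PowerSeries.C (1 / ν) * Phi ν 1 := by
  rw [Sser, mul_assoc, Phi0_inv hν, mul_one]

lemma Phi0_ne {ν : ℝ} (hν : ∀ k : ℕ, ν ≠ -(k : ℝ)) : Phi ν 0 ≠ 0 := by
  intro h; have := Phi0_const hν; rw [h] at this; simp at this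

lemma tau_eq {ν : ℝ} (hν : ∀ k : ℕ, ν ≠ -(k : ℝ)) :
    tau ν = PowerSeries.C ν + PowerSeries.X ^ 2 * Sser ν - PowerSeries.C (ν ^ 2) * Sser ν := by
  have h0 : ν ≠ 0 := by simpa using hν 0
  apply mul_right_cancel₀ (Phi0_ne hν)
  rw [tau_mul hν, sub_mul, add_mul, mul_assoc, mul_assoc, Sser_mul hν]
  have h1 : PowerSeries.C (ν ^ 2) * (PowerSeries.C (1 / ν) * Phi ν 1) = PowerSeries.C ν * Phi ν 1 := by
    rw [← mul_assoc, ← map_mul]; congr 2; field_simp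
  rw [h1]
  linear_combination -Phi_ode hν

lemma sigma_moment {ν : ℝ} (hν : ∀ k : ℕ, ν ≠ -(k : ℝ)) (k : ℕ) :
    sigmaBessel ν (k + 2) = PowerSeries.coeff k (Sser ν) - ν ^ 2 * PowerSeries.coeff (k + 2) (Sser ν) := by
  rw [sigma_eq hν (k + 1), tau_eq hν, show k + 1 + 1 = k + 2 from rfl, map_sub, map_add, PowerSeries.coeff_X_pow_mul, PowerSeries.coeff_C_mul,
    PowerSeries.coeff_C, if_neg (by omega), zero_add]

open Polynomial

noncomputable def Qp (ν : ℝ) : ℕ → ℝ[X]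
  | 0 => 1
  | 1 => X
  | m + 2 => X * Qp ν (m + 1) - C (lam ν m) * Qp ν m

noncomputable def hh (ν : ℝ) : ℕ → ℝ
  | 0 => 1 / ν
  | m + 1 => hh ν m * lam ν m

noncomputable def Lf (ν : ℝ) : ℝ[X] →ₗ[ℝ] ℝ :=
  Polynomial.lsum (fun k => (PowerSeries.coeff k (Sser ν)) • LinearMap.id)

lemma Lf_X_pow (ν : ℝ) (k : ℕ) : Lf ν (X ^ k) = PowerSeries.coeff k (Sser ν) := by
  rw [Lf, Polynomial.lsum_apply, Polynomial.X_pow_eq_monomial, Polynomial.sum_monomial_index]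
  · simp
  · simp

noncomputable def Psi (ν : ℝ) (m : ℕ) : PowerSeries ℝ := PowerSeries.mk fun i => Lf ν (Qp ν m * X ^ i)

lemma Psi_zero (ν : ℝ) : Psi ν 0 = Sser ν := by
  ext i; simp [Psi, Qp, Lf_X_pow]

lemma Psi_one (ν : ℝ) : PowerSeries.X * Psi ν 1 = Psi ν 0 - PowerSeries.C (PowerSeries.coeff 0 (Psi ν 0)) := by
  ext i
  cases i with
  | zero => simp
  | succ i =>
    rw [PowerSeries.coeff_succ_X_mul, map_sub, PowerSeries.coeff_C, if_neg (by omega)]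
    simp [Psi, Qp, pow_succ, mul_comm]

lemma Psi_succ (ν : ℝ) (m : ℕ) : PowerSeries.X * Psi ν (m + 2) =
    Psi ν (m + 1) - PowerSeries.C (PowerSeries.coeff 0 (Psi ν (m + 1))) -
      PowerSeries.X * (PowerSeries.C (lam ν m) * Psi ν m) := by
  ext i
  cases i with
  | zero => simp
  | succ i =>
    rw [PowerSeries.coeff_succ_X_mul, map_sub, map_sub, PowerSeries.coeff_C, if_neg (by omega),
      PowerSeries.coeff_succ_X_mul, PowerSeries.coeff_C_mul]
    simp only [Psi, PowerSeries.coeff_mk, Qp]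
    rw [sub_zero, ← smul_eq_mul (lam ν m), ← map_smul, ← map_sub]
    congr 1
    rw [Polynomial.smul_eq_C_mul]
    ring

lemma Psi_eq {ν : ℝ} (hν : ∀ k : ℕ, ν ≠ -(k : ℝ)) (m : ℕ) :
    Psi ν m * Phi ν 0 = PowerSeries.X ^ m * (PowerSeries.C (hh ν m) * Phi ν (m + 1)) := by
  induction m using Nat.twoStepInduction with
  | zero => rw [Psi_zero, Sser_mul hν, hh]; ring
  | one =>
    have hc : PowerSeries.coeff 0 (Psi ν 0) = 1 / ν := by
      have := congrArg (PowerSeries.coeff 0) (Sser_mul hν)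
      simp only [PowerSeries.coeff_zero_eq_constantCoeff_apply, map_mul, Phi0_const hν] at this
      rw [Psi_zero, PowerSeries.coeff_zero_eq_constantCoeff_apply, ← mul_one (PowerSeries.constantCoeff _), this]
      simp [Phi, bco, ← PowerSeries.coeff_zero_eq_constantCoeff_apply]
    apply mul_left_cancel₀ (PowerSeries.X_ne_zero (R := ℝ))
    rw [← mul_assoc, Psi_one, sub_mul, hc, Psi_zero, Sser_mul hν, hh, hh, map_mul]
    linear_combination - PowerSeries.C (1 / ν) * Phi_rec hν 0
  | more m ih1 ih2 =>
    have hc : PowerSeries.coeff 0 (Psi ν (m + 1)) = 0 := by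
      have := congrArg (PowerSeries.coeff 0) ih2
      simpa [PowerSeries.coeff_zero_eq_constantCoeff_apply, Phi0_const hν] using this
    apply mul_left_cancel₀ (PowerSeries.X_ne_zero (R := ℝ))
    rw [← mul_assoc, Psi_succ, hc, sub_mul, map_zero, sub_zero, ih2, mul_assoc, mul_assoc, ih1]
    have := Phi_rec hν (m + 1)
    simp only [hh, map_mul]
    linear_combination - PowerSeries.C (hh ν m) * PowerSeries.C (lam ν m) * PowerSeries.X ^ (m + 1) * this

lemma Psi_eq' {ν : ℝ} (hν : ∀ k : ℕ, ν ≠ -(k : ℝ)) (m : ℕ) :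
    Psi ν m = PowerSeries.X ^ m * (PowerSeries.C (hh ν m) * Phi ν (m + 1) * (Phi ν 0)⁻¹) := by
  apply mul_right_cancel₀ (Phi0_ne hν)
  rw [Psi_eq hν, mul_assoc, mul_assoc, Phi0_inv hν, mul_one]

lemma orth_lt {ν : ℝ} (hν : ∀ k : ℕ, ν ≠ -(k : ℝ)) {m i : ℕ} (h : i < m) :
    Lf ν (Qp ν m * X ^ i) = 0 := by
  have := congrArg (PowerSeries.coeff i) (Psi_eq' hν m)
  rw [PowerSeries.coeff_X_pow_mul', if_neg (by omega)] at this
  simpa [Psi] using this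

lemma orth_eq {ν : ℝ} (hν : ∀ k : ℕ, ν ≠ -(k : ℝ)) (m : ℕ) :
    Lf ν (Qp ν m * X ^ m) = hh ν m := by
  have := congrArg (PowerSeries.coeff m) (Psi_eq' hν m)
  rw [PowerSeries.coeff_X_pow_mul', if_pos le_rfl, Nat.sub_self] at this
  have h1 : PowerSeries.constantCoeff (Phi ν (m + 1)) = 1 := by
    simp [Phi, bco, ← PowerSeries.coeff_zero_eq_constantCoeff_apply]
  simpa [Psi, h1, Phi0_const hν] using this

lemma Qp_monic (ν : ℝ) (m : ℕ) : (Qp ν m).Monic ∧ (Qp ν m).natDegree = m := by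
  induction m using Nat.twoStepInduction with
  | zero => simp [Qp]
  | one => simp [Qp, monic_X]
  | more m ih1 ih2 =>
    have hm : (X * Qp ν (m + 1)).Monic := monic_X.mul ih2.1
    have hd : (X * Qp ν (m + 1)).natDegree = m + 2 := by
      rw [monic_X.natDegree_mul ih2.1, ih2.2, natDegree_X]; ring
    have hlt : (C (lam ν m) * Qp ν m).degree < (X * Qp ν (m + 1)).degree := by
      rw [degree_eq_natDegree hm.ne_zero, hd]
      rw [← smul_eq_C_mul]
      apply lt_of_le_of_lt (degree_smul_le _ _)
      rw [degree_eq_natDegree ih1.1.ne_zero, ih1.2]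
      exact_mod_cast (by omega : m < m + 2)
    constructor
    · rw [Qp]; exact hm.sub_of_left hlt
    · rw [Qp]
      rw [natDegree_eq_of_degree_eq (degree_sub_eq_left_of_degree_lt hlt), hd]

lemma Qp_parity (ν a : ℝ) (m : ℕ) : (Qp ν m).eval (-a) = (-1) ^ m * (Qp ν m).eval a := by
  induction m using Nat.twoStepInduction with
  | zero => simp [Qp]
  | one => simp [Qp]
  | more m ih1 ih2 =>
    simp only [Qp, eval_sub, eval_mul, eval_X, eval_C, ih1, ih2]
    ring

lemma functional_mul (L : ℝ[X] →ₗ[ℝ] ℝ) (N : ℕ) (p q : ℝ[X]) (hp : p.natDegree < N)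
    (hq : q.natDegree < N) :
    L (p * q) = ∑ k : Fin N, ∑ l : Fin N, p.coeff k * L (X ^ ((k : ℕ) + l)) * q.coeff l := by
  conv_lhs => rw [p.as_sum_range' N hp, q.as_sum_range' N hq]
  rw [Finset.sum_mul_sum, map_sum, ← Fin.sum_univ_eq_sum_range]
  apply Finset.sum_congr rfl; intro k _
  rw [map_sum, ← Fin.sum_univ_eq_sum_range]
  apply Finset.sum_congr rfl; intro l _
  rw [monomial_mul_monomial, ← mul_one (p.coeff _ * q.coeff _), ← smul_eq_mul, ← smul_monomial,
    map_smul, ← X_pow_eq_monomial]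
  simp only [smul_eq_mul]; ring

lemma orth_deg {ν : ℝ} (hν : ∀ k : ℕ, ν ≠ -(k : ℝ)) (m : ℕ) (p : ℝ[X]) (hp : p.natDegree < m) :
    Lf ν (Qp ν m * p) = 0 := by
  conv_lhs => rw [p.as_sum_range' m hp]
  rw [Finset.mul_sum, map_sum]
  apply Finset.sum_eq_zero
  intro k hk
  rw [← C_mul_X_pow_eq_monomial, mul_left_comm, ← smul_eq_C_mul, map_smul,
    orth_lt hν (Finset.mem_range.1 hk), smul_zero]

lemma orth_self {ν : ℝ} (hν : ∀ k : ℕ, ν ≠ -(k : ℝ)) (m : ℕ) :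
    Lf ν (Qp ν m * Qp ν m) = hh ν m := by
  obtain ⟨h1, h2⟩ := Qp_monic ν m
  cases m with
  | zero => have := orth_eq hν 0; simpa [Qp] using this
  | succ m =>
    have : Qp ν (m + 1) = (Qp ν (m + 1) - X ^ (m + 1)) + X ^ (m + 1) := by ring
    conv_lhs => rw [this, add_mul, map_add, ← this]
    have key : (Qp ν (m + 1) - X ^ (m + 1)).natDegree < m + 1 := by
      have hd : (Qp ν (m + 1) - X ^ (m + 1)).degree < (Qp ν (m + 1)).degree := by
        apply degree_sub_lt_left _ h1.ne_zero
        · rw [h1.leadingCoeff, (monic_X_pow _).leadingCoeff]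
        · rw [degree_X_pow, degree_eq_natDegree h1.ne_zero, h2]
      rw [degree_eq_natDegree h1.ne_zero, h2] at hd
      by_cases hz : Qp ν (m + 1) - X ^ (m + 1) = 0
      · rw [hz]; simp
      · exact (natDegree_lt_iff_degree_lt hz).2 hd
    rw [mul_comm, orth_deg hν _ _ key, zero_add, mul_comm, orth_eq hν]

lemma unitri_det (N : ℕ) (P : ℕ → ℝ[X]) (hm : ∀ i, (P i).Monic) (hd : ∀ i, (P i).natDegree = i) :
    (Matrix.of fun i j : Fin N => (P i).coeff j).det = 1 := by
  rw [Matrix.det_of_isLowerTriangular]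
  · apply Finset.prod_eq_one
    intro i _
    have := (hm i).coeff_natDegree
    rw [hd] at this
    simpa using this
  · intro i j hij
    have : (i : ℕ) < j := by simpa using hij
    rw [Matrix.of_apply]
    apply coeff_eq_zero_of_natDegree_lt
    rw [hd]; exact this

lemma exists_K (ν a : ℝ) (ha : a ≠ 0) (j : ℕ) (hj : (Qp ν j).eval a ≠ 0) :
    ∃ K : ℝ[X], K.Monic ∧ K.natDegree = j ∧
      (X ^ 2 - C (a ^ 2)) * K =
        Qp ν (j + 2) - C ((Qp ν (j + 2)).eval a / (Qp ν j).eval a) * Qp ν j := by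
  set p := Qp ν (j + 2) - C ((Qp ν (j + 2)).eval a / (Qp ν j).eval a) * Qp ν j with hp
  have h1 : p.eval a = 0 := by simp [hp]; field_simp; ring
  have h2 : p.eval (-a) = 0 := by
    have : p.eval (-a) = (-1) ^ j * p.eval a := by
      simp only [hp, eval_sub, eval_mul, eval_C, Qp_parity]; ring
    rw [this, h1, mul_zero]
  have hlt : (C ((Qp ν (j + 2)).eval a / (Qp ν j).eval a) * Qp ν j).degree < (Qp ν (j + 2)).degree := by
    rw [← smul_eq_C_mul]
    apply lt_of_le_of_lt (degree_smul_le _ _)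
    rw [degree_eq_natDegree (Qp_monic ν j).1.ne_zero, degree_eq_natDegree (Qp_monic ν _).1.ne_zero,
      (Qp_monic ν j).2, (Qp_monic ν (j + 2)).2]
    exact_mod_cast (by omega : j < j + 2)
  have hpm : p.Monic := (Qp_monic ν (j + 2)).1.sub_of_left hlt
  have hpd : p.natDegree = j + 2 := by
    rw [hp, natDegree_eq_of_degree_eq (degree_sub_eq_left_of_degree_lt hlt), (Qp_monic ν (j + 2)).2]
  have hco : IsCoprime (X - C a) (X - C (-a)) := by
    apply isCoprime_X_sub_C_of_isUnit_sub
    rw [isUnit_iff_ne_zero]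
    intro h; apply ha; linarith
  obtain ⟨K, hK⟩ := hco.mul_dvd (dvd_iff_isRoot.2 h1) (dvd_iff_isRoot.2 h2)
  have hw : (X - C a) * (X - C (-a)) = X ^ 2 - C (a ^ 2) := by
    simp only [map_neg, map_pow]; ring
  have hwm : ((X - C a) * (X - C (-a))).Monic := (monic_X_sub_C a).mul (monic_X_sub_C (-a))
  have hKm : K.Monic := hwm.of_mul_monic_left (hK ▸ hpm)
  refine ⟨K, hKm, ?_, ?_⟩
  · have := congrArg natDegree hK
    rw [hpd, hwm.natDegree_mul hKm, (monic_X_sub_C a).natDegree_mul (monic_X_sub_C (-a)),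
      natDegree_X_sub_C, natDegree_X_sub_C] at this
    omega
  · rw [← hw, hK]

lemma christoffel_generic {ν : ℝ} (hν : ∀ k : ℕ, ν ≠ -(k : ℝ)) (n : ℕ) (a : ℝ)
    (ha : ∀ j, j < n + 2 → (Qp ν j).eval a ≠ 0) :
    (Matrix.of fun i j : Fin (n + 1) => Lf ν (X ^ ((i : ℕ) + j + 2)) - a ^ 2 * Lf ν (X ^ ((i : ℕ) + j))).det
      * a = (-1) ^ (n + 1) * (∏ j ∈ Finset.range (n + 1), hh ν j) *
        ((Qp ν (n + 1)).eval a * (Qp ν (n + 2)).eval a) := by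
  have ha0 : a ≠ 0 := by simpa [Qp] using ha 1 (by omega)
  have hex : ∀ j : ℕ, ∃ K : ℝ[X], K.Monic ∧ K.natDegree = j ∧ (j < n + 1 →
      (X ^ 2 - C (a ^ 2)) * K =
        Qp ν (j + 2) - C ((Qp ν (j + 2)).eval a / (Qp ν j).eval a) * Qp ν j) := by
    intro j
    by_cases hj : j < n + 1
    · obtain ⟨K, h1, h2, h3⟩ := exists_K ν a ha0 j (ha j (by omega))
      exact ⟨K, h1, h2, fun _ => h3⟩
    · exact ⟨X ^ j, monic_X_pow j, natDegree_X_pow j, fun h => absurd h hj⟩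
  choose K hKm hKd hK using hex
  set H := (Matrix.of fun i j : Fin (n + 1) =>
    Lf ν (X ^ ((i : ℕ) + j + 2)) - a ^ 2 * Lf ν (X ^ ((i : ℕ) + j))) with hH
  set P : Matrix (Fin (n + 1)) (Fin (n + 1)) ℝ := Matrix.of fun i j => (Qp ν i).coeff j with hP
  set R : Matrix (Fin (n + 1)) (Fin (n + 1)) ℝ := Matrix.of fun i j => (K i).coeff j with hR
  have hPd : P.det = 1 := unitri_det _ (Qp ν) (fun i => (Qp_monic ν i).1) (fun i => (Qp_monic ν i).2)
  have hRd : R.det = 1 := unitri_det _ K hKm hKd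
  have hent : ∀ i j, (P * H * R.transpose) i j = Lf ν (Qp ν i * Qp ν (j + 2)) -
      (Qp ν (j + 2)).eval a / (Qp ν j).eval a * Lf ν (Qp ν i * Qp ν j) := by
    intro i j
    have e1 := functional_mul (Lf ν ∘ₗ LinearMap.mulLeft ℝ (X ^ 2 - C (a ^ 2))) (n + 1) (Qp ν i) (K j)
      (by rw [(Qp_monic ν i).2]; exact i.2) (by rw [hKd]; exact j.2)
    have e2 : (Lf ν ∘ₗ LinearMap.mulLeft ℝ (X ^ 2 - C (a ^ 2))) (Qp ν i * K j) =
        Lf ν (Qp ν i * Qp ν (j + 2)) -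
      (Qp ν (j + 2)).eval a / (Qp ν j).eval a * Lf ν (Qp ν i * Qp ν j) := by
      rw [LinearMap.comp_apply, LinearMap.mulLeft_apply, mul_left_comm, hK j j.2, mul_sub, map_sub,
        mul_left_comm, ← smul_eq_C_mul, map_smul, smul_eq_mul]
    rw [← e2, e1, Matrix.mul_apply, Finset.sum_comm]
    apply Finset.sum_congr rfl; intro l _
    rw [Matrix.mul_apply, Finset.sum_mul]
    apply Finset.sum_congr rfl; intro k _
    simp only [hP, hH, hR, Matrix.of_apply, Matrix.transpose_apply]
    congr 2
    rw [LinearMap.comp_apply, LinearMap.mulLeft_apply, sub_mul, map_sub, ← smul_eq_C_mul, map_smul,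
      smul_eq_mul]
    congr 2
    ring
  have hdet : H.det = ∏ j : Fin (n + 1), (-((Qp ν (j + 2)).eval a / (Qp ν j).eval a * hh ν j)) := by
    have : (P * H * R.transpose).det = H.det := by
      rw [Matrix.det_mul, Matrix.det_mul, Matrix.det_transpose, hPd, hRd]; ring
    rw [← this, Matrix.det_of_isLowerTriangular]
    · apply Finset.prod_congr rfl
      intro j _
      rw [hent, orth_self hν, mul_comm, orth_deg hν _ _ (by rw [(Qp_monic ν j).2]; omega)]
      ring
    · intro i j hij
      have hij : (i : ℕ) < j := by simpa using hij
      rw [hent, mul_comm (Qp ν i), orth_deg hν _ _ (by rw [(Qp_monic ν i).2]; omega),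
        mul_comm (Qp ν i), orth_deg hν _ _ (by rw [(Qp_monic ν i).2]; omega)]
      ring
  rw [hdet, Fin.prod_univ_eq_prod_range
    (fun j => -((Qp ν (j + 2)).eval a / (Qp ν j).eval a * hh ν j)) (n + 1)]
  clear hdet hent hPd hRd hP hR hH hK hKm hKd H P R K
  induction n with
  | zero =>
    simp [Qp]
    field_simp
  | succ n ih =>
    have ih' := ih (fun j hj => ha j (by omega))
    rw [Finset.prod_range_succ, Finset.prod_range_succ (fun j => hh ν j), mul_right_comm, ih', pow_succ]
    have := ha (n + 1) (by omega)
    have := ha (n + 2) (by omega)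
    field_simp
    ring

lemma christoffel {ν : ℝ} (hν : ∀ k : ℕ, ν ≠ -(k : ℝ)) (n : ℕ) (a : ℝ) :
    (Matrix.of fun i j : Fin (n + 1) => Lf ν (X ^ ((i : ℕ) + j + 2)) - a ^ 2 * Lf ν (X ^ ((i : ℕ) + j))).det
      * a = (-1) ^ (n + 1) * (∏ j ∈ Finset.range (n + 1), hh ν j) *
        ((Qp ν (n + 1)).eval a * (Qp ν (n + 2)).eval a) := by
  set B : ℝ[X] := ∏ j ∈ Finset.range (n + 2), Qp ν j with hB
  have hB0 : B ≠ 0 := Finset.prod_ne_zero_iff.2 fun j _ => (Qp_monic ν j).1.ne_zero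
  have hfin : {x | B.IsRoot x}.Finite := Polynomial.finite_setOfPred_isRoot hB0
  have hdense : Dense ({x | B.IsRoot x}ᶜ) := hfin.countable.dense_compl ℝ
  have hc1 : Continuous fun a : ℝ => (Matrix.of fun i j : Fin (n + 1) =>
      Lf ν (X ^ ((i : ℕ) + j + 2)) - a ^ 2 * Lf ν (X ^ ((i : ℕ) + j))).det * a := by
    apply Continuous.mul _ continuous_id
    apply Continuous.matrix_det
    apply continuous_matrix
    intro i j
    simp only [Matrix.of_apply]
    fun_prop
  have hc2 : Continuous fun a : ℝ => (-1) ^ (n + 1) * (∏ j ∈ Finset.range (n + 1), hh ν j) *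
        ((Qp ν (n + 1)).eval a * (Qp ν (n + 2)).eval a) := by fun_prop
  refine congrFun (Continuous.ext_on hdense hc1 hc2 ?_) a
  intro x hx
  apply christoffel_generic hν
  intro j hj h
  apply hx
  simp only [Set.mem_ofPred_eq, IsRoot, hB, eval_prod]
  exact Finset.prod_eq_zero (Finset.mem_range.2 hj) h

lemma Qp_eval {ν : ℝ} (m : ℕ) (x : ℝ) : (Qp ν (m + 1)).eval x = 2 * qpoly ν (m + 1) x := by
  induction m using Nat.twoStepInduction with
  | zero => simp [Qp, qpoly]; ring
  | one =>
    have : (4 * ν * (ν + 1))⁻¹ = 4⁻¹ * ν⁻¹ * (ν + 1)⁻¹ := by rw [mul_inv, mul_inv]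
    simp [Qp, qpoly, lam, div_eq_mul_inv, this]; ring
  | more m ih1 ih2 =>
    rw [Qp, qpoly, eval_sub, eval_mul, eval_mul, eval_X, eval_C, ih1, ih2, lam, if_neg (by omega)]
    ring

/-- closed form of the norms -/
lemma hh_eq {ν : ℝ} (hν : ∀ k : ℕ, ν ≠ -(k : ℝ)) (j : ℕ) :
    hh ν (j + 1) * (ν ^ 2 * 4 ^ (j + 1) * (∏ k ∈ Finset.Icc 1 j, (ν + k)) ^ 2 * (ν + j + 1)) = 2 := by
  have hne := nu_add_ne hν
  have h0 : ν ≠ 0 := by simpa using hν 0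
  have h1 : ν + 1 ≠ 0 := by simpa using hne 1
  induction j with
  | zero => simp [hh, lam]; field_simp
  | succ j ih =>
    rw [hh, lam, if_neg (by omega), Finset.prod_Icc_succ_top (by omega), ← ih]
    have a1 := hne (j + 1)
    have a2 := hne (j + 1 + 1)
    push_cast at *
    have a3 : ν + (j + 1) + 1 ≠ 0 := by rwa [add_assoc]
    field_simp
    ring

lemma hh_prod {ν : ℝ} (hν : ∀ k : ℕ, ν ≠ -(k : ℝ)) (n : ℕ) :
    (∏ j ∈ Finset.range (n + 1), hh ν j) * (ν ^ (2 * n + 1) * (2 : ℝ) ^ ((n : ℤ) ^ 2) *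
      ∏ k ∈ Finset.Icc 1 n, (ν + k) ^ (2 * (n - k) + 1)) = 1 := by
  have h0 : ν ≠ 0 := by simpa using hν 0
  induction n with
  | zero => simp [hh, h0]
  | succ n ih =>
    have e : ∏ k ∈ Finset.Icc 1 (n + 1), (ν + k) ^ (2 * (n + 1 - k) + 1) =
        (∏ k ∈ Finset.Icc 1 n, (ν + k) ^ (2 * (n - k) + 1)) *
          (∏ k ∈ Finset.Icc 1 n, (ν + k)) ^ 2 * (ν + n + 1) := by
      rw [Finset.prod_Icc_succ_top (by omega), ← Finset.prod_pow, ← Finset.prod_mul_distrib]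
      congr 1
      · apply Finset.prod_congr rfl
        intro k hk
        rw [← pow_add]
        congr 1
        have := (Finset.mem_Icc.1 hk).2
        omega
      · simp; ring
    have e2 : (2 : ℝ) ^ (((n + 1 : ℕ) : ℤ) ^ 2) * 2 = (2 : ℝ) ^ ((n : ℤ) ^ 2) * 4 ^ (n + 1) := by
      have : ((n + 1 : ℕ) : ℤ) ^ 2 = (n : ℤ) ^ 2 + ((2 * n + 1 : ℕ) : ℤ) := by push_cast; ring
      rw [this, zpow_add₀ (by norm_num), zpow_natCast, mul_assoc, ← pow_succ,
        show (4 : ℝ) = 2 ^ 2 by norm_num, ← pow_mul]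
      rfl
    rw [Finset.prod_range_succ, e]
    have h3 := hh_eq hν n
    have h4 : (2 : ℝ) ^ (((n + 1 : ℕ) : ℤ) ^ 2) = (2 : ℝ) ^ ((n : ℤ) ^ 2) * 4 ^ (n + 1) / 2 := by
      rw [← e2]; ring
    rw [h4]
    set Pn := ∏ j ∈ Finset.range (n + 1), hh ν j
    set A := ∏ k ∈ Finset.Icc 1 n, (ν + k) ^ (2 * (n - k) + 1)
    set B := ∏ k ∈ Finset.Icc 1 n, (ν + (k : ℝ))
    set Z := (2 : ℝ) ^ ((n : ℤ) ^ 2)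
    calc _ = (Pn * (ν ^ (2 * n + 1) * Z * A)) *
          (hh ν (n + 1) * (ν ^ 2 * 4 ^ (n + 1) * B ^ 2 * (ν + n + 1))) / 2 := by ring
      _ = 1 := by rw [ih, h3]; norm_num

/-- Explicit formula for the Hankel determinant `Δ_n`. -/
theorem hankelDelta_formula (ν : ℝ) (hν : ∀ k : ℕ, ν ≠ -(k : ℝ)) (n : ℕ) (hn : 1 ≤ n) :
    hankelDelta ν n =
      ν ^ 2 * qpoly ν (n + 1) (1 / ν) * qpoly ν (n + 2) (1 / ν) /
        ((2 : ℝ) ^ ((n : ℤ) ^ 2 - 2) *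
          ∏ k ∈ Finset.Icc 1 n, (ν + k) ^ (2 * (n - k) + 1)) := by
  have h0 : ν ≠ 0 := by simpa using hν 0
  have hch := christoffel hν n (1 / ν)
  have hnp := hh_prod hν n
  have hH : (Matrix.of fun i j : Fin (n + 1) => sigmaBessel ν ((i : ℕ) + (j : ℕ) + 2)) =
      (-ν ^ 2) • (Matrix.of fun i j : Fin (n + 1) =>
        Lf ν (Polynomial.X ^ ((i : ℕ) + j + 2)) -
          (1 / ν) ^ 2 * Lf ν (Polynomial.X ^ ((i : ℕ) + j))) := by
    ext i j
    simp only [Matrix.of_apply, Matrix.smul_apply, smul_eq_mul, sigma_moment hν, Lf_X_pow]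
    field_simp
    ring
  rw [hankelDelta, hH, Matrix.det_smul, Fintype.card_fin]
  rw [Qp_eval, show n + 2 = (n + 1) + 1 from rfl, Qp_eval] at hch
  have hz : (2 : ℝ) ^ ((n : ℤ) ^ 2 - 2) = (2 : ℝ) ^ ((n : ℤ) ^ 2) / 4 := by
    rw [zpow_sub₀ (by norm_num)]; norm_num
  rw [hz]
  set D := (Matrix.of fun i j : Fin (n + 1) =>
        Lf ν (Polynomial.X ^ ((i : ℕ) + j + 2)) -
          (1 / ν) ^ 2 * Lf ν (Polynomial.X ^ ((i : ℕ) + j))).det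
  set Pn := ∏ j ∈ Finset.range (n + 1), hh ν j
  set A := ∏ k ∈ Finset.Icc 1 n, (ν + k) ^ (2 * (n - k) + 1)
  set Z := (2 : ℝ) ^ ((n : ℤ) ^ 2)
  set q1 := qpoly ν (n + 1) (1 / ν)
  set q2 := qpoly ν (n + 1 + 1) (1 / ν)
  have hA : A ≠ 0 := by rintro h; rw [h] at hnp; simp at hnp
  have hZ : Z ≠ 0 := by rintro h; rw [h] at hnp; simp at hnp
  have hD : D = (-1) ^ (n + 1) * Pn * (2 * q1 * (2 * q2)) * ν := by
    rw [← hch]; field_simp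
  have hs : ((-1 : ℝ) ^ (n + 1)) * (-1) ^ (n + 1) = 1 := by rw [← mul_pow]; simp
  rw [eq_div_iff (by positivity), hD, neg_pow]
  calc _ = ((-1 : ℝ) ^ (n + 1) * (-1) ^ (n + 1)) * (Pn * (ν ^ (2 * n + 1) * Z * A)) *
        (ν ^ 2 * q1 * q2) := by ring
    _ = _ := by rw [hs, hnp]; ring
end
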